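/- arXiv:math/0110176 — 3 statements merged into one kernel-verified Lean document; each statement's English description precedes it below -/
import Mathlib

section
/- Let G be a finitely generated generalized Baumslag–Solitar group with G not isomorphic to ℤ. Then G has exactly one end. -/
open SimpleGraph

section Defs

variable {G V : Type} [Group G]

/-- The action `ρ` preserves adjacency of the graph `X`. -/
def PreservesAdj (X : SimpleGraph V) (ρ : G →* Equiv.Perm V) : Prop :=
  ∀ (g : G) (u v : V), X.Adj u v → X.Adj (ρ g u) (ρ g v)

/-- The action is without inversions: no element swaps the endpoints of an edge. -/
def NoInversions (X : SimpleGraph V) (ρ : G →* Equiv.Perm V) : Prop :=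
  ∀ (g : G) (u v : V), X.Adj u v → ¬(ρ g u = v ∧ ρ g v = u)

/-- `X` together with `ρ` is a `G`-tree: a tree with a `G`-action by graph
automorphisms, without inversions. -/
def IsGTree (X : SimpleGraph V) (ρ : G →* Equiv.Perm V) : Prop :=
  X.IsTree ∧ PreservesAdj X ρ ∧ NoInversions X ρ

/-- The stabilizer of a vertex. -/
def vStab (ρ : G →* Equiv.Perm V) (v : V) : Subgroup G :=
  (MulAction.stabilizer (Equiv.Perm V) v).comap ρ

/-- The stabilizer of an edge (for an action without inversions this is the
intersection of the stabilizers of the two endpoints). -/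
def eStab (ρ : G →* Equiv.Perm V) (u v : V) : Subgroup G :=
  vStab ρ u ⊓ vStab ρ v

/-- An element is elliptic if it fixes a vertex; it is hyperbolic otherwise. -/
def Elliptic (ρ : G →* Equiv.Perm V) (γ : G) : Prop := ∃ v : V, ρ γ v = v

/-- A (bi-infinite) line in a graph. -/
def IsLine (X : SimpleGraph V) (L : Set V) : Prop :=
  ∃ f : ℤ → V, Function.Injective f ∧ (∀ n : ℤ, X.Adj (f n) (f (n + 1))) ∧ L = Set.range f

/-- A set of vertices invariant under the element `γ`. -/
def InvariantSet (ρ : G →* Equiv.Perm V) (γ : G) (L : Set V) : Prop :=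
  ⇑(ρ γ) '' L = L

/-- An axis for `γ` : a `γ`-invariant line. (A hyperbolic element has a unique one.) -/
def IsAxis (X : SimpleGraph V) (ρ : G →* Equiv.Perm V) (γ : G) (L : Set V) : Prop :=
  IsLine X L ∧ InvariantSet ρ γ L

/-- A subgroup is infinite cyclic. -/
def IsInfCyclic {G : Type} [Group G] (H : Subgroup G) : Prop := IsCyclic H ∧ Infinite H

/-- A generalized Baumslag–Solitar tree: a `G`-tree all of whose vertex and edge
stabilizers are infinite cyclic. -/
def IsGBSTree (X : SimpleGraph V) (ρ : G →* Equiv.Perm V) : Prop :=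
  IsGTree X ρ ∧ (∀ v : V, IsInfCyclic (vStab ρ v)) ∧
    (∀ u v : V, X.Adj u v → IsInfCyclic (eStab ρ u v))

/-- Two group elements are commensurable: some nonzero powers of them coincide. -/
def CommElts (γ δ : G) : Prop := ∃ m n : ℤ, m ≠ 0 ∧ n ≠ 0 ∧ γ ^ m = δ ^ n

/-- A generalized Baumslag–Solitar group: a group admitting a GBS tree. -/
def IsGBSGroup (G : Type) [Group G] : Prop :=
  ∃ (V : Type) (X : SimpleGraph V) (ρ : G →* Equiv.Perm V), IsGBSTree X ρ

/-- A group is free: isomorphic to a free group on some set. -/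
def IsFreeGrp (G : Type) [Group G] : Prop := ∃ ι : Type, Nonempty (G ≃* FreeGroup ι)

/-- The orbit of the edge `{a, b}` under the action. -/
def EdgeOrbit (ρ : G →* Equiv.Perm V) (a b : V) : Set (Sym2 V) :=
  {e | ∃ g : G, e = s(ρ g a, ρ g b)}

/-- A one-edge splitting of `G` over `C`: a `G`-tree with a single orbit of edges,
no global fixed vertex, and an edge with stabilizer `C` (this is the Bass–Serre
tree of a nontrivial decomposition `A ∗_C B` or `A ∗_C`). -/
def OneEdgeSplitting (X : SimpleGraph V) (ρ : G →* Equiv.Perm V) (u v : V)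
    (C : Subgroup G) : Prop :=
  IsGTree X ρ ∧ X.Adj u v ∧ eStab ρ u v = C ∧
  (¬ ∃ w : V, ∀ g : G, ρ g w = w) ∧
  (∀ u' v' : V, X.Adj u' v' → ∃ g : G, (ρ g u = u' ∧ ρ g v = v') ∨ (ρ g u = v' ∧ ρ g v = u'))

/-- `G` splits over the subgroup `C`. -/
def SplitsOver (G : Type) [Group G] (C : Subgroup G) : Prop :=
  ∃ (W : Type) (T : SimpleGraph W) (σ : G →* Equiv.Perm W) (u v : W),
    OneEdgeSplitting T σ u v C

/-- Cayley graph of a group with respect to a set of generators. -/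
def cayley (G : Type) [Group G] (S : Set G) : SimpleGraph G :=
  SimpleGraph.fromRel (fun a b => a⁻¹ * b ∈ S)

end Defs

lemma gbs_almost_inv {G : Type} [Group G] (S : Set G) (hS : Subgroup.closure S = ⊤) (D : Set G)
    (h : ∀ s ∈ S, {x | ¬(x ∈ D ↔ x * s ∈ D)}.Finite) (g : G) :
    {x | ¬(x ∈ D ↔ x * g ∈ D)}.Finite := by
  have hg : g ∈ Subgroup.closure S := by rw [hS]; trivial
  induction hg using Subgroup.closure_induction with
  | mem s hs => exact h s hs
  | one => simp
  | mul a b _ _ ha hb =>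
    refine (ha.union (hb.preimage (f := fun x => x * a) (mul_left_injective a).injOn)).subset ?_
    intro x hx
    simp only [Set.mem_ofPred_eq, Set.mem_union, Set.mem_preimage, mul_assoc] at hx ⊢
    tauto
  | inv a _ ha =>
    refine (ha.preimage (f := fun x => x * a⁻¹) (mul_left_injective a⁻¹).injOn).subset ?_
    intro x hx
    simp only [Set.mem_ofPred_eq, Set.mem_preimage, inv_mul_cancel_right] at hx ⊢
    tauto

lemma gbs_mono {G : Type} [Group G] (C : Subgroup G) (c : G)
    (hc : ∀ x ∈ C, ∃ n : ℤ, c ^ n = x) (hcC : c ∈ C) (D : Set G) (x : G)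
    (hx : ∀ y : G, (y : G ⧸ C) = (x : G ⧸ C) → (y ∈ D ↔ y * c ∈ D)) (a : G) (ha : a ∈ C) :
    x ∈ D ↔ x * a ∈ D := by
  obtain ⟨n, rfl⟩ := hc a ha
  have key : ∀ n : ℤ, ((x * c ^ n : G) : G ⧸ C) = (x : G ⧸ C) := by
    intro n
    rw [eq_comm, QuotientGroup.eq]
    simpa using C.zpow_mem hcC n
  clear ha
  induction n using Int.induction_on with
  | zero => simp
  | succ n ih =>
    refine ih.trans ((hx _ (key n)).trans ?_)
    rw [zpow_add_one, mul_assoc]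
  | pred n ih =>
    refine ih.trans (Iff.symm ((hx _ (key (-n - 1))).trans ?_))
    rw [mul_assoc, ← zpow_add_one, sub_add_cancel]

lemma gbs_core1 {G : Type} [Group G] (C : Subgroup G) (c : G)
    (hc : ∀ x ∈ C, ∃ n : ℤ, c ^ n = x) (hcC : c ∈ C) (hCinf : Infinite C)
    (hcov : ∀ g : G, ∃ T : Set G, T.Finite ∧ ∀ a ∈ C, ∃ t ∈ T, ∃ b ∈ C, g * a = b * t)
    (D : Set G) (hD : ∀ g, {x | ¬(x ∈ D ↔ x * g ∈ D)}.Finite)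
    (x : G) (hx : ∀ a ∈ C, x * a ∈ D) : Dᶜ.Finite := by
  have h1 : ∀ g : G, {y | ∃ a ∈ C, y = x * g * a ∧ y ∉ D}.Finite := by
    intro g
    obtain ⟨T, hT, hT'⟩ := hcov g
    refine (hT.biUnion (fun t _ => (hD t).image (fun y => y * t))).subset ?_
    rintro y ⟨a, ha, rfl, hy⟩
    obtain ⟨t, ht, b, hb, e⟩ := hT' a ha
    rw [mul_assoc, e, ← mul_assoc] at hy ⊢
    simp only [Set.mem_iUnion]
    refine ⟨t, ht, x * b, ?_, rfl⟩
    have := hx b hb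
    simp [this, hy]
  have h2 : ∀ z : G, {y : G | (y : G ⧸ C) = (z : G ⧸ C) ∧ y ∉ D}.Finite := by
    intro z
    refine (h1 (x⁻¹ * z)).subset ?_
    rintro y ⟨hy, hyD⟩
    refine ⟨z⁻¹ * y, ?_, by group, hyD⟩
    exact QuotientGroup.eq.1 hy.symm
  refine ((hD c).biUnion (fun z _ => h2 z)).subset ?_
  intro y hy
  by_contra hcon
  have hmono : ∀ z : G, (z : G ⧸ C) = (y : G ⧸ C) → (z ∈ D ↔ z * c ∈ D) := by
    intro z hz
    by_contra hz'
    apply hcon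
    simp only [Set.mem_iUnion]
    exact ⟨z, hz', hz.symm, hy⟩
  have h3 := gbs_mono C c hc hcC D y hmono
  refine Set.infinite_of_injective_forall_mem (f := fun a : C => y * (a : G)) ?_ ?_ (h2 y)
  · intro a b hab
    exact Subtype.ext (mul_left_cancel hab)
  · intro a
    refine ⟨?_, fun h => hy ((h3 a a.2).2 h)⟩
    rw [eq_comm, QuotientGroup.eq]
    simp

lemma gbs_core {G : Type} [Group G] (C : Subgroup G) (c : G)
    (hc : ∀ x ∈ C, ∃ n : ℤ, c ^ n = x) (hcC : c ∈ C) (hCinf : Infinite C)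
    (hind : Infinite (G ⧸ C))
    (hcov : ∀ g : G, ∃ T : Set G, T.Finite ∧ ∀ a ∈ C, ∃ t ∈ T, ∃ b ∈ C, g * a = b * t)
    (D : Set G) (hD : ∀ g, {x | ¬(x ∈ D ↔ x * g ∈ D)}.Finite) : D.Finite ∨ Dᶜ.Finite := by
  obtain ⟨q, hq⟩ := ((hD c).image (fun x : G => (x : G ⧸ C))).exists_notMem
  obtain ⟨x, rfl⟩ := QuotientGroup.mk_surjective q
  have h3 := gbs_mono C c hc hcC D x (by
    intro y hy
    by_contra h
    exact hq ⟨y, h, hy⟩)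
  by_cases hx : x ∈ D
  · right
    exact gbs_core1 C c hc hcC hCinf hcov D hD x (fun a ha => (h3 a ha).1 hx)
  · left
    rw [← compl_compl D]
    refine gbs_core1 C c hc hcC hCinf hcov Dᶜ ?_ x (fun a ha h => hx ((h3 a ha).2 h))
    intro g
    convert hD g using 3
    simp only [Set.mem_compl_iff]
    tauto

/-- Strict quasi-convexity of distance in a tree. -/
lemma gbs_tree_mid {V : Type} (X : SimpleGraph V) (hX : X.IsTree) (x x' : V) (hne : x ≠ x')
    (hadj : ¬ X.Adj x x') :
    ∃ m : V, ∀ y : V, X.dist m y < X.dist x y ∨ X.dist m y < X.dist x' y := by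
  classical
  have hpl : ∀ {u v : V} (p : X.Walk u v), p.IsPath → ∀ m ∈ p.support, m ≠ u →
      X.dist m v < X.dist u v := by
    intro u v p hp m hm hmu
    obtain ⟨q, hq⟩ := hX.1.exists_walk_length_eq_dist u v
    have hqp := q.isPath_of_length_eq_dist hq
    have : p = q := congrArg Subtype.val (hX.2.path_unique ⟨p, hp⟩ ⟨q, hqp⟩)
    subst this
    have h1 := congrArg Walk.length (p.take_spec hm)
    rw [Walk.length_append] at h1
    have h2 := dist_le (p.dropUntil m hm)
    have h3 : 0 < (p.takeUntil m hm).length := by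
      rw [Nat.pos_iff_ne_zero]
      intro h0
      exact hmu (Walk.eq_of_length_eq_zero h0).symm
    omega
  obtain ⟨w, hw⟩ := hX.1.exists_walk_length_eq_dist x x'
  have hwp := w.isPath_of_length_eq_dist hw
  have hm : ∃ m ∈ w.support, m ≠ x ∧ m ≠ x' := by
    cases w with
    | nil => exact absurd rfl hne
    | cons h p =>
      rename_i v
      refine ⟨v, by simp, h.ne.symm, ?_⟩
      rintro rfl
      exact hadj h
  obtain ⟨m, hmw, hmx, hmx'⟩ := hm
  refine ⟨m, fun y => ?_⟩
  obtain ⟨p, hp⟩ := hX.1.exists_walk_length_eq_dist x y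
  have hpp := p.isPath_of_length_eq_dist hp
  obtain ⟨q, hq⟩ := hX.1.exists_walk_length_eq_dist x' y
  have hqp := q.isPath_of_length_eq_dist hq
  have hb : w = (p.append q.reverse).bypass :=
    congrArg Subtype.val (hX.2.path_unique ⟨w, hwp⟩ ⟨_, Walk.bypass_isPath _⟩)
  rw [hb] at hmw
  have := Walk.support_bypass_subset_support _ hmw
  rw [Walk.mem_support_append_iff, Walk.support_reverse, List.mem_reverse] at this
  rcases this with h | h
  · exact Or.inl (hpl p hpp m h hmx)
  · exact Or.inr (hpl q hqp m h hmx')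

lemma gbs_dist {G V : Type} [Group G] (X : SimpleGraph V) (ρ : G →* Equiv.Perm V)
    (hX : IsGTree X ρ) (g : G) (u v : V) : X.dist (ρ g u) (ρ g v) = X.dist u v := by
  have hle : ∀ (g : G) (u v : V), X.dist (ρ g u) (ρ g v) ≤ X.dist u v := by
    intro g u v
    obtain ⟨p, hp⟩ := hX.1.1.exists_walk_length_eq_dist u v
    let f : X →g X := ⟨ρ g, fun {a b} h => hX.2.1 g a b h⟩
    have := dist_le (p.map f)
    rw [Walk.length_map, hp] at this
    exact this
  refine le_antisymm (hle g u v) ?_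
  have := hle g⁻¹ (ρ g u) (ρ g v)
  simpa using this

lemma gbs_fixed {G V : Type} [Group G] (X : SimpleGraph V) (ρ : G →* Equiv.Perm V)
    (hX : IsGTree X ρ) (v0 : V) (hfin : (Set.range (fun g => ρ g v0)).Finite) :
    ∃ v : V, ∀ g, ρ g v = v := by
  classical
  let F := hfin.toFinset
  have hF : ∀ g y, ρ g y ∈ F ↔ y ∈ F := by
    intro g y
    simp only [F, Set.Finite.mem_toFinset, Set.mem_range]
    constructor
    · rintro ⟨h, hh⟩
      exact ⟨g⁻¹ * h, by simp [hh]⟩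
    · rintro ⟨h, rfl⟩
      exact ⟨g * h, by simp⟩
  have hF0 : F.Nonempty := ⟨v0, by simp only [F, Set.Finite.mem_toFinset]; exact ⟨1, by simp⟩⟩
  let e : V → ℕ := fun x => F.sup (fun y => X.dist x y)
  have he : ∀ g x, e (ρ g x) ≤ e x := by
    intro g x
    refine Finset.sup_le fun y hy => ?_
    have h1 : ρ g⁻¹ y ∈ F := (hF _ _).2 hy
    have h2 := gbs_dist X ρ hX g x (ρ g⁻¹ y)
    have h3 : ρ g (ρ g⁻¹ y) = y := by simp
    rw [h3] at h2
    rw [h2]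
    exact Finset.le_sup (f := fun y => X.dist x y) h1
  obtain ⟨x, hx⟩ : ∃ x, ∀ y, e x ≤ e y :=
    haveI : Nonempty V := ⟨v0⟩
    ⟨Function.argmin e, fun y => Function.argmin_le e y⟩
  have hadj : ∀ a b, e a ≤ e x → e b ≤ e x → a ≠ b → X.Adj a b := by
    intro a b ha hb hab
    by_contra hn
    obtain ⟨m, hm⟩ := gbs_tree_mid X hX.1 a b hab hn
    obtain ⟨y, hy, hye⟩ := Finset.exists_mem_eq_sup F hF0 (fun y => X.dist m y)
    have h1 : e m = X.dist m y := hye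
    have h2 := hx m
    have h3 : X.dist a y ≤ e a := Finset.le_sup (f := fun y => X.dist a y) hy
    have h4 : X.dist b y ≤ e b := Finset.le_sup (f := fun y => X.dist b y) hy
    rcases hm y with h | h <;> omega
  refine ⟨x, fun g => ?_⟩
  by_contra hg
  have e1 := he g x
  have e2 := (he g (ρ g x)).trans e1
  have a1 := hadj x (ρ g x) le_rfl e1 (Ne.symm hg)
  have a2 := hX.2.1 g _ _ a1
  have hne : x ≠ ρ g (ρ g x) := fun h => hX.2.2 g _ _ a1 ⟨rfl, h.symm⟩
  have a3 := hadj x _ le_rfl e2 hne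
  exact hX.1.2.cliqueFree (le_refl 3) _ (is3Clique_triple_iff.2 ⟨a1, a3, a2⟩)

/-- `A` is covered by finitely many left translates of `B`. -/
def GbsCov {G : Type} [Group G] (A B : Subgroup G) : Prop :=
  ∃ T : Set G, T.Finite ∧ ∀ a ∈ A, ∃ t ∈ T, ∃ b ∈ B, a = t * b

lemma gbs_cov_trans {G : Type} [Group G] {A B C : Subgroup G} (h : GbsCov A B) (h' : GbsCov B C) :
    GbsCov A C := by
  obtain ⟨T, hT, h⟩ := h
  obtain ⟨U, hU, h'⟩ := h'
  refine ⟨Set.image2 (fun t u => t * u) T U, hT.image2 _ hU, fun a ha => ?_⟩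
  obtain ⟨t, ht, b, hb, rfl⟩ := h a ha
  obtain ⟨u, hu, c, hc, rfl⟩ := h' b hb
  exact ⟨t * u, ⟨t, ht, u, hu, rfl⟩, c, hc, by group⟩

lemma gbs_cov_cyclic {G : Type} [Group G] (A B : Subgroup G) (hA : IsInfCyclic A)
    (hAB : IsInfCyclic (A ⊓ B)) : GbsCov A B := by
  obtain ⟨⟨⟨a, ha⟩, hgen⟩⟩ := hA.1
  have := hAB.2
  obtain ⟨⟨x, hx⟩, hx1⟩ := exists_ne (1 : (A ⊓ B : Subgroup G))
  obtain ⟨k, hk⟩ := Subgroup.mem_zpowers_iff.1 (hgen ⟨x, hx.1⟩)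
  have hk' : a ^ k = x := by simpa using congrArg Subtype.val hk
  have hk0 : k ≠ 0 := by
    rintro rfl
    apply hx1
    apply Subtype.ext
    simpa using hk'.symm
  refine ⟨(fun i : ℤ => a ^ i) '' (Set.Ico 0 |k|), (Set.finite_Ico _ _).image _, fun y hy => ?_⟩
  obtain ⟨n, hn⟩ := Subgroup.mem_zpowers_iff.1 (hgen ⟨y, hy⟩)
  have hn' : a ^ n = y := by simpa using congrArg Subtype.val hn
  refine ⟨a ^ (n % k), ⟨n % k, ⟨Int.emod_nonneg _ hk0, Int.emod_lt_abs _ hk0⟩, rfl⟩,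
    a ^ (k * (n / k)), ?_, ?_⟩
  · rw [zpow_mul, hk']
    exact B.zpow_mem hx.2 _
  · rw [← zpow_add, Int.emod_add_mul_ediv, hn']

lemma gbs_cov {G V : Type} [Group G] (X : SimpleGraph V) (ρ : G →* Equiv.Perm V)
    (h : IsGBSTree X ρ) (u v : V) : GbsCov (vStab ρ u) (vStab ρ v) := by
  obtain ⟨p⟩ := h.1.1.1.preconnected u v
  induction p with
  | nil => exact ⟨{1}, Set.finite_singleton _, fun a ha => ⟨1, rfl, a, ha, by simp⟩⟩
  | cons hadj p ih =>
    exact gbs_cov_trans (gbs_cov_cyclic _ _ (h.2.1 _) (h.2.2 _ _ hadj)) ih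

lemma gbs_cayley_preconn {G : Type} [Group G] (S : Set G) (hS : Subgroup.closure S = ⊤) :
    (cayley G S).Preconnected := by
  have hstep : ∀ x, ∀ s ∈ S, (cayley G S).Reachable x (x * s) := by
    intro x s hs
    by_cases hxs : x = x * s
    · rw [← hxs]
    · exact Adj.reachable ((fromRel_adj _ _ _).2 ⟨hxs, Or.inl (by simpa using hs)⟩)
  have key : ∀ g x, (cayley G S).Reachable x (x * g) := by
    intro g
    have hg : g ∈ Subgroup.closure S := by rw [hS]; trivial
    induction hg using Subgroup.closure_induction with
    | mem s hs => exact fun x => hstep x s hs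
    | one => intro x; simp
    | mul a b _ _ ha hb =>
      intro x
      rw [← mul_assoc]
      exact (ha x).trans (hb _)
    | inv a _ ha =>
      intro x
      have := (ha (x * a⁻¹)).symm
      simpa using this
  intro x y
  simpa using key (x⁻¹ * y) x

/-- A finitely generated generalized Baumslag–Solitar group not
isomorphic to `ℤ` has exactly one end (the Cayley graph with respect to any
finite generating set has exactly one end). -/
theorem gbs_one_ended {G : Type} [Group G] (hG : IsGBSGroup G) (hfg : Group.FG G)
    (hZ : ¬ Nonempty (G ≃* Multiplicative ℤ)) :
    ∀ S : Finset G, Subgroup.closure (S : Set G) = ⊤ →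
      Nat.card (SimpleGraph.end (cayley G (S : Set G))) = 1 := by
  classical
  intro S hS
  obtain ⟨V, X, ρ, hX⟩ := hG
  obtain ⟨v0⟩ := hX.1.1.1.nonempty
  have hmem : ∀ v g, g ∈ vStab ρ v ↔ ρ g v = v := by
    intro v g
    rfl
  have hnofix : ¬ ∃ v : V, ∀ g, ρ g v = v := by
    rintro ⟨v, hv⟩
    have htop : vStab ρ v = ⊤ := by
      rw [eq_top_iff]
      exact fun g _ => (hmem v g).2 (hv g)
    obtain ⟨h1, h2⟩ := hX.2.1 v
    rw [htop] at h1 h2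
    have e1 : (⊤ : Subgroup G) ≃* Multiplicative ℤ :=
      mulEquivOfCyclicCardEq (by rw [Nat.card_eq_zero_of_infinite, Nat.card_eq_zero_of_infinite])
    exact hZ ⟨Subgroup.topEquiv.symm.trans e1⟩
  set C := vStab ρ v0 with hC
  obtain ⟨hCcyc, hCinf⟩ := hX.2.1 v0
  obtain ⟨⟨⟨c, hcC⟩, hgen⟩⟩ := hCcyc
  have hc : ∀ x ∈ C, ∃ n : ℤ, c ^ n = x := by
    intro x hx
    obtain ⟨n, hn⟩ := Subgroup.mem_zpowers_iff.1 (hgen ⟨x, hx⟩)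
    exact ⟨n, by simpa using congrArg Subtype.val hn⟩
  have hind : Infinite (G ⧸ C) := by
    by_contra hfin
    rw [not_infinite_iff_finite] at hfin
    refine hnofix (gbs_fixed X ρ hX.1 v0 ?_)
    refine (Set.finite_range (fun q : G ⧸ C => ρ q.out v0)).subset ?_
    rintro _ ⟨g, rfl⟩
    refine ⟨(g : G ⧸ C), ?_⟩
    have h1 : ((g : G ⧸ C).out : G ⧸ C) = g := Quotient.out_eq' _
    have h2 := (hmem v0 _).1 (QuotientGroup.eq.1 h1)
    rw [map_mul, Equiv.Perm.mul_apply, map_inv, Equiv.Perm.inv_eq_iff_eq] at h2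
    exact h2.symm
  have hcov : ∀ g : G, ∃ T : Set G, T.Finite ∧ ∀ a ∈ C, ∃ t ∈ T, ∃ b ∈ C, g * a = b * t := by
    intro g
    obtain ⟨T, hT, h⟩ := gbs_cov X ρ hX (ρ g v0) v0
    refine ⟨(fun t => t⁻¹ * g) '' T, hT.image _, fun a ha => ?_⟩
    have h1 : (g * a * g⁻¹)⁻¹ ∈ vStab ρ (ρ g v0) := by
      apply Subgroup.inv_mem
      rw [hmem]
      have := (hmem v0 a).1 ha
      simp [this]
    obtain ⟨t, ht, b, hb, e⟩ := h _ h1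
    refine ⟨_, ⟨t, ht, rfl⟩, b⁻¹, C.inv_mem hb, ?_⟩
    have e2 : g * a * g⁻¹ = (t * b)⁻¹ := by rw [← e, inv_inv]
    have e3 : g * a = (t * b)⁻¹ * g := by rw [← e2]; group
    rw [e3]
    group
  have hGinf : Infinite G := Infinite.of_injective (fun a : C => (a : G)) Subtype.val_injective
  set Γ := cayley G (S : Set G) with hΓ
  have hadj : ∀ x, ∀ s ∈ S, x ≠ x * s → Γ.Adj x (x * s) := fun x s hs hne =>
    (fromRel_adj _ _ _).2 ⟨hne, Or.inl (by simpa using hs)⟩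
  have hpre : Γ.Preconnected := gbs_cayley_preconn _ hS
  have hcomp : ∀ (K : Finset G) (D : Γ.ComponentCompl K),
      (D : Set G).Finite ∨ (D : Set G)ᶜ.Finite := by
    intro K D
    refine gbs_core C c hc hcC hCinf hind hcov D (gbs_almost_inv _ hS _ ?_)
    intro s hs
    refine (K.finite_toSet.union
      (K.finite_toSet.preimage (f := fun x => x * s) (mul_left_injective s).injOn)).subset ?_
    intro x hx
    by_contra hcon
    simp only [Set.mem_union, Set.mem_preimage, not_or] at hcon
    obtain ⟨k1, k2⟩ := hcon
    apply hx
    by_cases hne : x = x * s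
    · rw [← hne]
    · have ha := hadj x s hs hne
      exact ⟨fun h => ComponentCompl.mem_of_adj _ _ h k2 ha,
        fun h => ComponentCompl.mem_of_adj _ _ h k1 ha.symm⟩
  have hlf : LocallyFinite Γ := by
    intro x
    apply Set.Finite.fintype
    refine ((S.finite_toSet.image (fun s => x * s)).union
      (S.finite_toSet.image (fun s => x * s⁻¹))).subset ?_
    intro y hy
    have hy' : x ≠ y ∧ (x⁻¹ * y ∈ (S : Set G) ∨ y⁻¹ * x ∈ (S : Set G)) := hy
    rcases hy'.2 with h | h
    · exact Or.inl ⟨_, h, by simp⟩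
    · exact Or.inr ⟨_, h, by simp⟩
  haveI : Fact Γ.Preconnected := ⟨hpre⟩
  obtain ⟨e0, he0⟩ := nonempty_ends_of_infinite Γ
  rw [Nat.card_eq_one_iff_unique]
  refine ⟨⟨fun e e' => ?_⟩, ⟨⟨e0, he0⟩⟩⟩
  apply Subtype.ext
  funext K
  by_contra hne
  have i1 := end_componentCompl_infinite Γ e K
  have i2 := end_componentCompl_infinite Γ e' K
  have hdis := ComponentCompl.pairwise_disjoint hne
  rcases hcomp _ (e.val K) with h | h
  · exact i1 h
  · exact i2 (h.subset (fun x hx hx' => Set.disjoint_left.1 hdis hx' hx))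
end

section
/- Let X be a generalized Baumslag–Solitar tree with group G not isomorphic to ℤ. Then X contains a G-invariant line if and only if G is isomorphic to ℤ × ℤ or to the Klein bottle group ⟨a, b | bab⁻¹ = a⁻¹⟩. -/
open SimpleGraph

/-- The Klein bottle group `⟨a, b | b * a * b⁻¹ = a⁻¹⟩`. -/
def KleinBottleGroup : Type :=
  PresentedGroup ({FreeGroup.of 1 * FreeGroup.of 0 * (FreeGroup.of 1)⁻¹ * FreeGroup.of 0} :
    Set (FreeGroup (Fin 2)))

instance : Group KleinBottleGroup := by unfold KleinBottleGroup; infer_instance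


section TreeLemmas

variable {V : Type} {X : SimpleGraph V}

/-- In a tree, at most one neighbour of a vertex is closer to a given root. -/
lemma tree_far (hT : X.IsTree) (r : V) {v w₁ w₂ : V} (h1 : X.Adj v w₁) (h2 : X.Adj v w₂)
    (hne : w₁ ≠ w₂) (hd : X.dist r v = X.dist r w₁ + 1) : X.dist r w₂ = X.dist r v + 1 := by
  rcases hT.dist_eq_dist_add_one_of_adj r h2 with h | h
  · exfalso
    apply hne
    obtain ⟨p, hp⟩ := hT.connected.exists_walk_length_eq_dist r w₁
    obtain ⟨q, hq⟩ := hT.connected.exists_walk_length_eq_dist r w₂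
    have hp' : (p.concat h1.symm).IsPath := by
      apply Walk.isPath_of_length_eq_dist
      rw [Walk.length_concat, hp, hd]
    have hq' : (q.concat h2.symm).IsPath := by
      apply Walk.isPath_of_length_eq_dist
      rw [Walk.length_concat, hq, h]
    have := (hT.isAcyclic.subsingleton_path _ _).elim ⟨_, hp'⟩ ⟨_, hq'⟩
    have h3 : p.concat h1.symm = q.concat h2.symm := congrArg Subtype.val this
    have h4 := congrArg Walk.penultimate h3
    simpa using h4
  · exact h

/-- Distances to a root propagate along non-backtracking sequences. -/
lemma tree_propagate (hT : X.IsTree) (r : V) (f : ℕ → V) (N : ℕ)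
    (hadj : ∀ n, n < N → X.Adj (f n) (f (n + 1)))
    (hnb : ∀ n, n + 2 ≤ N → f n ≠ f (n + 2))
    (h1 : 1 ≤ N → X.dist r (f 1) = X.dist r (f 0) + 1) :
    ∀ n, n ≤ N → X.dist r (f n) = X.dist r (f 0) + n := by
  intro n
  induction n using Nat.strong_induction_on with
  | _ n ih =>
    intro hn
    match n, ih, hn with
    | 0, _, _ => simp
    | 1, _, hn => exact h1 hn
    | (k + 2), ih, hn =>
      have i1 := ih (k + 1) (by omega) (by omega)
      have i0 := ih k (by omega) (by omega)
      have := tree_far hT r (hadj k (by omega)).symm (hadj (k + 1) (by omega))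
        (hnb k hn) (by omega)
      have e : k + 1 + 1 = k + 2 := rfl
      rw [e] at this
      omega

/-- Geodesics as sequences. -/
lemma tree_geod (hT : X.IsTree) (u v : V) : ∃ p : ℕ → V, p 0 = u ∧ p (X.dist u v) = v ∧
    (∀ n, n < X.dist u v → X.Adj (p n) (p (n + 1))) ∧
    (∀ n, n ≤ X.dist u v → X.dist u (p n) = n ∧ X.dist (p n) v + n = X.dist u v) := by
  obtain ⟨w, hw⟩ := hT.connected.exists_walk_length_eq_dist u v
  refine ⟨w.getVert, by simp, by rw [← hw]; simp, ?_, ?_⟩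
  · intro n hn
    exact w.adj_getVert_succ (by omega)
  · intro n hn
    have a := dist_le (w.take n)
    have b := dist_le (w.drop n)
    have c := hT.connected.dist_triangle (u := u) (v := w.getVert n) (w := v)
    simp only [Walk.take_length, Walk.drop_length] at a b
    omega

/-- Uniqueness of points on a geodesic. -/
lemma tree_geod_unique (hT : X.IsTree) {u v w w' : V}
    (h1 : X.dist u w + X.dist w v = X.dist u v)
    (h2 : X.dist u w' + X.dist w' v = X.dist u v) (h3 : X.dist u w = X.dist u w') : w = w' := by
  obtain ⟨p, hp⟩ := hT.connected.exists_walk_length_eq_dist u w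
  obtain ⟨q, hq⟩ := hT.connected.exists_walk_length_eq_dist w v
  obtain ⟨p', hp'⟩ := hT.connected.exists_walk_length_eq_dist u w'
  obtain ⟨q', hq'⟩ := hT.connected.exists_walk_length_eq_dist w' v
  have i1 : (p.append q).IsPath := by
    apply Walk.isPath_of_length_eq_dist
    rw [Walk.length_append]; omega
  have i2 : (p'.append q').IsPath := by
    apply Walk.isPath_of_length_eq_dist
    rw [Walk.length_append]; omega
  have h : p.append q = p'.append q' :=
    congrArg Subtype.val ((hT.isAcyclic.subsingleton_path _ _).elim ⟨_, i1⟩ ⟨_, i2⟩)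
  have h4 := congrArg (fun z => Walk.getVert z (X.dist u w)) h
  simp only [Walk.getVert_append] at h4
  rw [if_neg (by omega), if_neg (by omega)] at h4
  have e1 : X.dist u w - p.length = 0 := by omega
  have e2 : X.dist u w - p'.length = 0 := by omega
  rw [e1, e2] at h4
  simpa using h4

/-- Non-backtracking bi-infinite sequences are geodesic. -/
lemma line_dist (hT : X.IsTree) (f : ℤ → V) (hadj : ∀ n : ℤ, X.Adj (f n) (f (n + 1)))
    (hnb : ∀ n : ℤ, f n ≠ f (n + 2)) (a : ℤ) (n : ℕ) : X.dist (f a) (f (a + n)) = n := by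
  have := tree_propagate hT (f a) (fun k : ℕ => f (a + k)) n
    (fun k _ => by have := hadj (a + k); simpa [add_assoc] using this)
    (fun k _ => by have := hnb (a + k); simpa [add_assoc] using this)
    (fun _ => by simpa using hadj a) n le_rfl
  simpa using this

lemma line_inj (hT : X.IsTree) (f : ℤ → V) (hadj : ∀ n : ℤ, X.Adj (f n) (f (n + 1)))
    (hnb : ∀ n : ℤ, f n ≠ f (n + 2)) : Function.Injective f := by
  have key : ∀ a b : ℤ, a ≤ b → f a = f b → a = b := by
    intro a b hab h
    obtain ⟨n, rfl⟩ := Int.le.dest hab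
    have := line_dist hT f hadj hnb a n
    rw [← h] at this
    simp at this
    omega
  intro a b h
  rcases le_total a b with hab | hab
  · exact key a b hab h
  · exact (key b a hab h.symm).symm

lemma line_adj (hT : X.IsTree) (f : ℤ → V) (hadj : ∀ n : ℤ, X.Adj (f n) (f (n + 1)))
    (hinj : Function.Injective f) {a b : ℤ} (h : X.Adj (f a) (f b)) : b = a + 1 ∨ b = a - 1 := by
  have hnb : ∀ n : ℤ, f n ≠ f (n + 2) := fun n hn => by
    have := hinj hn
    omega
  have h1 : X.dist (f a) (f b) = 1 := dist_eq_one_iff_adj.2 h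
  rcases le_total a b with hab | hab
  · obtain ⟨n, rfl⟩ := Int.le.dest hab
    rw [line_dist hT f hadj hnb] at h1
    omega
  · obtain ⟨n, rfl⟩ := Int.le.dest hab
    rw [dist_comm, line_dist hT f hadj hnb] at h1
    omega

/-- Every vertex has a projection to a line. -/
lemma line_proj (hT : X.IsTree) (f : ℤ → V) (hadj : ∀ n : ℤ, X.Adj (f n) (f (n + 1)))
    (hinj : Function.Injective f) (v : V) :
    ∃ m : ℤ, ∀ n : ℕ, X.dist v (f (m + n)) = X.dist v (f m) + n ∧
      X.dist v (f (m - n)) = X.dist v (f m) + n := by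
  classical
  obtain ⟨m, hm⟩ : ∃ m : ℤ, ∀ k : ℤ, X.dist v (f m) ≤ X.dist v (f k) := by
    have hex : ∃ d : ℕ, ∃ k : ℤ, X.dist v (f k) = d := ⟨_, 0, rfl⟩
    obtain ⟨m, hm⟩ := Nat.find_spec hex
    exact ⟨m, fun k => by rw [hm]; exact Nat.find_min' hex ⟨k, rfl⟩⟩
  have hm1 : X.dist v (f (m + 1)) = X.dist v (f m) + 1 := by
    have := hm (m + 1)
    have := hT.dist_eq_dist_add_one_of_adj v (hadj m)
    omega
  have hadj' : X.Adj (f m) (f (m - 1)) := by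
    have := hadj (m - 1)
    rw [sub_add_cancel] at this
    exact this.symm
  have hm2 : X.dist v (f (m - 1)) = X.dist v (f m) + 1 := by
    have := hm (m - 1)
    have := hT.dist_eq_dist_add_one_of_adj v hadj'
    omega
  refine ⟨m, fun n => ⟨?_, ?_⟩⟩
  · have := tree_propagate hT v (fun k : ℕ => f (m + k)) n
      (fun k _ => by have := hadj (m + k); simpa [add_assoc] using this)
      (fun k _ h => by have := hinj h; push_cast at this; omega)
      (fun _ => by simpa using hm1) n le_rfl
    simpa using this
  · have := tree_propagate hT v (fun k : ℕ => f (m - k)) n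
      (fun k _ => by
        have := hadj (m - k - 1)
        rw [sub_add_cancel] at this
        push_cast
        rw [← sub_sub]
        exact this.symm)
      (fun k _ h => by have := hinj h; push_cast at this; omega)
      (fun _ => by simpa using hm2) n le_rfl
    simpa using this

end TreeLemmas

section Converse

variable {G V : Type} [Group G] {X : SimpleGraph V} {ρ : G →* Equiv.Perm V}

lemma act_dist_le (hT : X.IsTree) (hρ : PreservesAdj X ρ) (g : G) (u v : V) :
    X.dist (ρ g u) (ρ g v) ≤ X.dist u v := by
  obtain ⟨w, hw⟩ := hT.connected.exists_walk_length_eq_dist u v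
  let φ : X →g X := ⟨ρ g, fun {a b} h => hρ g a b h⟩
  have := SimpleGraph.dist_le (w.map φ)
  rw [Walk.length_map, hw] at this
  exact this

lemma act_dist (hT : X.IsTree) (hρ : PreservesAdj X ρ) (g : G) (u v : V) :
    X.dist (ρ g u) (ρ g v) = X.dist u v := by
  apply le_antisymm (act_dist_le hT hρ g u v)
  have := act_dist_le hT hρ g⁻¹ (ρ g u) (ρ g v)
  simpa using this

lemma seq_dist_le (hT : X.IsTree) (p : ℕ → V) (N : ℕ)
    (hadj : ∀ n, n < N → X.Adj (p n) (p (n + 1))) (i k : ℕ) (h : i + k ≤ N) :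
    X.dist (p i) (p (i + k)) ≤ k := by
  induction k with
  | zero => simp
  | succ k ih =>
    have h1 := ih (by omega)
    have h2 := hT.connected.dist_triangle (u := p i) (v := p (i + k)) (w := p (i + (k + 1)))
    have h3 : X.dist (p (i + k)) (p (i + (k + 1))) = 1 :=
      SimpleGraph.dist_eq_one_iff_adj.2 (hadj (i + k) (by omega))
    omega

/-- The set of vertices of minimal displacement. -/
def minSet (X : SimpleGraph V) (ρ : G →* Equiv.Perm V) (t : G) : Set V :=
  {v | ∀ w, X.dist v (ρ t v) ≤ X.dist w (ρ t w)}

lemma minSet_subset_line (hT : X.IsTree) (hρ : PreservesAdj X ρ) (t : G)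
    (f : ℤ → V) (hadj : ∀ n : ℤ, X.Adj (f n) (f (n + 1))) (hinj : Function.Injective f)
    (l : ℕ) (hl : 0 < l) (ht : ∀ n, ρ t (f n) = f (n + l))
    (v : V) (hv : X.dist v (ρ t v) ≤ l) : v ∈ Set.range f := by
  obtain ⟨m, hm⟩ := line_proj hT f hadj hinj v
  by_cases hd : X.dist v (f m) = 0
  · exact ⟨m, (hT.connected.dist_eq_zero_iff.1 hd).symm⟩
  exfalso
  have e0 : X.dist (f (m + l)) (ρ t v) = X.dist v (f m) := by
    rw [← ht, act_dist hT hρ, SimpleGraph.dist_comm]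
  obtain ⟨q, q0, qd, qadj, qdist⟩ := tree_geod hT (f (m + l)) (ρ t v)
  rw [e0] at qd qadj qdist
  have a1 := (hm l).1
  have a2 := (hm (l - 1)).1
  have hprev : X.Adj (f (m + l)) (f (m + (l - 1 : ℕ))) := by
    have := hadj (m + (l - 1 : ℕ))
    have e : m + ((l - 1 : ℕ) : ℤ) + 1 = m + l := by omega
    rw [e] at this
    exact this.symm
  have hne : f (m + (l - 1 : ℕ)) ≠ q 1 := by
    intro h
    have h1 := (qdist 1 (by omega)).2
    rw [← h] at h1
    have h2 : X.dist (f (m + (l - 1 : ℕ))) (ρ t v) = X.dist v (f (m - 1)) := by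
      have e : m + ((l - 1 : ℕ) : ℤ) = (m - 1) + l := by omega
      rw [e, ← ht, act_dist hT hρ, SimpleGraph.dist_comm]
    have h3 := (hm 1).2
    simp only [Nat.cast_one] at h3
    omega
  have hq1 : X.Adj (f (m + l)) (q 1) := by
    have := qadj 0 (by omega)
    rwa [q0] at this
  have b1 := tree_far hT v hprev hq1 hne (by omega)
  have b2 := tree_propagate hT v q (X.dist v (f m)) qadj
    (fun n hn h => by
      have c1 := (qdist n (by omega)).1
      have c2 := (qdist (n + 2) (by omega)).1
      rw [← h] at c2
      omega)
    (fun _ => by rw [b1, q0]) _ le_rfl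
  rw [qd, q0] at b2
  omega

lemma minSet_isLine (hT : X.IsTree) (hρ : PreservesAdj X ρ) (hni : NoInversions X ρ) (t : G)
    (hyp : ¬ Elliptic ρ t) : IsLine X (minSet X ρ t) := by
  classical
  obtain ⟨v, hv⟩ : ∃ v : V, ∀ w, X.dist v (ρ t v) ≤ X.dist w (ρ t w) := by
    obtain ⟨v0⟩ := hT.connected.nonempty
    have hex : ∃ d : ℕ, ∃ k : V, X.dist k (ρ t k) = d := ⟨_, v0, rfl⟩
    obtain ⟨m, hm⟩ := Nat.find_spec hex
    exact ⟨m, fun k => by rw [hm]; exact Nat.find_min' hex ⟨k, rfl⟩⟩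
  obtain ⟨p, p0, pl, padj, pdist⟩ := tree_geod hT v (ρ t v)
  obtain ⟨l, hl⟩ : ∃ l, l = X.dist v (ρ t v) := ⟨_, rfl⟩
  rw [← hl] at pl padj pdist
  simp only [← hl] at hv
  have lpos : 0 < l := by
    rw [Nat.pos_iff_ne_zero]
    intro h
    rw [h] at hl
    exact hyp ⟨v, (hT.connected.dist_eq_zero_iff.1 hl.symm).symm⟩
  have lposZ : (0 : ℤ) < l := by exact_mod_cast lpos
  let f : ℤ → V := fun n => ρ (t ^ (n / l)) (p (n % l).toNat)
  have hf0 : ∀ (q : ℤ) (r : ℕ), r < l → f (l * q + r) = ρ (t ^ q) (p r) := by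
    intro q r hr
    have e1 : ((l : ℤ) * q + r) / l = q := by
      rw [add_comm, Int.add_mul_ediv_left _ _ lposZ.ne', Int.ediv_eq_zero_of_lt (by omega) (by omega)]
      simp
    have e2 : (((l : ℤ) * q + r) % l) = r := by
      rw [add_comm, Int.add_mul_emod_self_left]
      exact Int.emod_eq_of_lt (by omega) (by omega)
    simp only [f, e1, e2, Int.toNat_natCast]
  have hsucc : ∀ (q : ℤ) (x : V), ρ (t ^ (q + 1)) x = ρ (t ^ q) (ρ t x) := by
    intro q x
    rw [zpow_add, zpow_one, map_mul, Equiv.Perm.mul_apply]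
  have hf : ∀ (q : ℤ) (r : ℕ), r ≤ l → f (l * q + r) = ρ (t ^ q) (p r) := by
    intro q r hr
    rcases hr.lt_or_eq with h | h
    · exact hf0 q r h
    · have := hf0 (q + 1) 0 lpos
      rw [hsucc, p0] at this
      rw [h, pl, ← this]
      congr 1
      push_cast
      ring
  have hdec : ∀ n : ℤ, ∃ (q : ℤ) (r : ℕ), r < l ∧ n = l * q + r := by
    intro n
    refine ⟨n / l, (n % l).toNat, ?_, ?_⟩
    · have := Int.emod_lt_of_pos n lposZ
      omega
    · have := Int.emod_nonneg n lposZ.ne'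
      rw [Int.toNat_of_nonneg this]
      exact (Int.mul_ediv_add_emod n l).symm
  have hadj : ∀ n : ℤ, X.Adj (f n) (f (n + 1)) := by
    intro n
    obtain ⟨q, r, hr, rfl⟩ := hdec n
    have e : (l : ℤ) * q + r + 1 = l * q + (r + 1 : ℕ) := by push_cast; ring
    rw [e, hf q r hr.le, hf q (r + 1) hr]
    exact hρ _ _ _ (padj r hr)
  have hjoint : p (l - 1) ≠ ρ t (p 1) := by
    intro h
    rcases Nat.lt_or_ge 1 l with h1 | h1
    · have a := seq_dist_le hT p l padj 1 (l - 2) (by omega)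
      have b := hv (p 1)
      have e : 1 + (l - 2) = l - 1 := by omega
      rw [e, h] at a
      omega
    · have e : l = 1 := by omega
      subst e
      simp only [Nat.sub_self] at h
      have ha := padj 0 (by omega)
      rw [pl, p0] at ha
      rw [pl, p0] at h
      exact hni t v (ρ t v) ha ⟨rfl, h.symm⟩
  have hnb : ∀ n : ℤ, f n ≠ f (n + 2) := by
    intro n
    obtain ⟨q, r, hr, rfl⟩ := hdec n
    rcases Nat.lt_or_ge (r + 1) l with h1 | h1
    · have e : (l : ℤ) * q + r + 2 = l * q + (r + 2 : ℕ) := by push_cast; ring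
      rw [e, hf q r hr.le, hf q (r + 2) h1]
      intro h
      have h := (ρ (t ^ q)).injective h
      have c1 := (pdist r (by omega)).1
      have c2 := (pdist (r + 2) (by omega)).1
      rw [← h] at c2
      omega
    · have e : (l : ℤ) * q + r + 2 = l * (q + 1) + (1 : ℕ) := by
        have : (r : ℤ) + 1 = l := by omega
        rw [← this]; push_cast; ring
      rw [e, hf q r hr.le, hf (q + 1) 1 (by omega), hsucc]
      intro h
      have h := (ρ (t ^ q)).injective h
      have e : r = l - 1 := by omega
      rw [e] at h
      exact hjoint h
  have hinj := line_inj hT f hadj hnb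
  have ht : ∀ n, ρ t (f n) = f (n + l) := by
    intro n
    obtain ⟨q, r, hr, rfl⟩ := hdec n
    have e : (l : ℤ) * q + r + l = l * (q + 1) + r := by ring
    rw [e, hf q r hr.le, hf (q + 1) r hr.le, add_comm q 1, zpow_add, zpow_one, map_mul,
      Equiv.Perm.mul_apply]
  refine ⟨f, hinj, hadj, ?_⟩
  ext w
  constructor
  · intro hw
    exact minSet_subset_line hT hρ t f hadj hinj l lpos ht w (by rw [hl]; exact hw v)
  · rintro ⟨n, rfl⟩ w
    rw [ht, line_dist hT f hadj hnb]
    exact hv w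

lemma minSet_inv (hT : X.IsTree) (hρ : PreservesAdj X ρ) (t : G) :
    minSet X ρ t⁻¹ = minSet X ρ t := by
  have : ∀ w, X.dist w (ρ t⁻¹ w) = X.dist w (ρ t w) := by
    intro w
    rw [← act_dist hT hρ t, SimpleGraph.dist_comm]
    simp
  ext v
  simp only [minSet, Set.mem_ofPred_eq, this]

lemma minSet_conj (hT : X.IsTree) (hρ : PreservesAdj X ρ) (t g : G) (v : V)
    (hv : v ∈ minSet X ρ t) : ρ g v ∈ minSet X ρ (g * t * g⁻¹) := by
  intro w
  have h := hv (ρ g⁻¹ w)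
  rw [← act_dist hT hρ g v, ← act_dist hT hρ g (ρ g⁻¹ w)] at h
  simpa [map_mul] using h

lemma minSet_invariant (hT : X.IsTree) (hρ : PreservesAdj X ρ) (t : G)
    (h : ∀ g : G, g * t * g⁻¹ = t ∨ g * t * g⁻¹ = t⁻¹) (g : G) :
    ⇑(ρ g) '' (minSet X ρ t) = minSet X ρ t := by
  have key : ∀ g : G, ∀ v ∈ minSet X ρ t, ρ g v ∈ minSet X ρ t := by
    intro g v hv
    have := minSet_conj hT hρ t g v hv
    rcases h g with e | e
    · rwa [e] at this
    · rwa [e, minSet_inv hT hρ] at this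
  ext v
  constructor
  · rintro ⟨w, hw, rfl⟩
    exact key g w hw
  · intro hv
    exact ⟨ρ g⁻¹ v, key g⁻¹ v hv, by simp⟩

/-- Commuting elliptic elements have a common fixed vertex. -/
lemma common_fixed (hT : X.IsTree) (hρ : PreservesAdj X ρ) (a c : G) (hac : a * c = c * a)
    (ha : Elliptic ρ a) (hc : Elliptic ρ c) : ∃ v, ρ a v = v ∧ ρ c v = v := by
  classical
  obtain ⟨u, hu⟩ := ha
  obtain ⟨w, hw, hmin⟩ : ∃ w, ρ c w = w ∧ ∀ w', ρ c w' = w' → X.dist u w ≤ X.dist u w' := by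
    obtain ⟨w0, hw0⟩ := hc
    have hex : ∃ d : ℕ, ∃ k : V, ρ c k = k ∧ X.dist u k = d := ⟨_, w0, hw0, rfl⟩
    obtain ⟨m, hm, hm'⟩ := Nat.find_spec hex
    exact ⟨m, hm, fun k hk => by rw [hm']; exact Nat.find_min' hex ⟨k, hk, rfl⟩⟩
  refine ⟨w, ?_, hw⟩
  by_contra hne
  have hcw' : ρ c (ρ a w) = ρ a w := by
    rw [← Equiv.Perm.mul_apply, ← map_mul, ← hac, map_mul, Equiv.Perm.mul_apply, hw]
  have hdw : X.dist u (ρ a w) = X.dist u w := by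
    conv_lhs => rw [← hu]
    exact act_dist hT hρ a u w
  -- every vertex on the geodesic from w to a w is fixed by c
  obtain ⟨p, p0, pl, padj, pdist⟩ := tree_geod hT w (ρ a w)
  have hpos : 0 < X.dist w (ρ a w) := hT.connected.pos_dist_of_ne (Ne.symm hne)
  have hfix : ∀ n, n ≤ X.dist w (ρ a w) → ρ c (p n) = p n := by
    intro n hn
    obtain ⟨d1, d2⟩ := pdist n hn
    have e1 : X.dist w (ρ c (p n)) = X.dist w (p n) := by
      conv_lhs => rw [← hw]
      exact act_dist hT hρ c _ _
    have e2 : X.dist (ρ c (p n)) (ρ a w) = X.dist (p n) (ρ a w) := by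
      conv_lhs => rw [← hcw']
      exact act_dist hT hρ c _ _
    exact tree_geod_unique hT (u := w) (v := ρ a w) (by omega) (by omega) e1
  have h1 : X.dist u (p 1) = X.dist u (p 0) + 1 := by
    have a1 := hmin _ (hfix 1 hpos)
    have a2 := hT.dist_eq_dist_add_one_of_adj u (padj 0 hpos)
    rw [p0] at a2 ⊢
    simp only [zero_add] at a2
    omega
  have h2 := tree_propagate hT u p _ padj (fun n hn h => by
      have c1 := (pdist n (by omega)).1
      have c2 := (pdist (n + 2) (by omega)).1
      rw [← h] at c2
      omega) (fun _ => h1) _ le_rfl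
  rw [pl, p0, hdw] at h2
  omega

lemma converse_line (hX : IsGBSTree X ρ) (a c : G) (hac : a * c = c * a)
    (hnc : ¬ ∃ x : G, a ∈ Subgroup.zpowers x ∧ c ∈ Subgroup.zpowers x)
    (ha : ∀ g : G, g * a * g⁻¹ = a ∨ g * a * g⁻¹ = a⁻¹)
    (hc : ∀ g : G, g * c * g⁻¹ = c ∨ g * c * g⁻¹ = c⁻¹) :
    ∃ L : Set V, IsLine X L ∧ ∀ g : G, ⇑(ρ g) '' L = L := by
  obtain ⟨⟨hT, hρ, hni⟩, hv, -⟩ := hX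
  by_cases ea : Elliptic ρ a
  · by_cases ec : Elliptic ρ c
    · exfalso
      obtain ⟨v, h1, h2⟩ := common_fixed hT hρ a c hac ea ec
      have hcyc : IsCyclic (vStab ρ v) := (hv v).1
      obtain ⟨x, hx⟩ := hcyc.exists_generator
      apply hnc
      refine ⟨x, ?_, ?_⟩
      · obtain ⟨k, hk⟩ := hx ⟨a, h1⟩
        exact ⟨k, by simpa using congrArg Subtype.val hk⟩
      · obtain ⟨k, hk⟩ := hx ⟨c, h2⟩
        exact ⟨k, by simpa using congrArg Subtype.val hk⟩
    · exact ⟨_, minSet_isLine hT hρ hni c ec, minSet_invariant hT hρ c hc⟩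
  · exact ⟨_, minSet_isLine hT hρ hni a ea, minSet_invariant hT hρ a ha⟩

end Converse

section KleinLemmas

/-- First generator of the Klein bottle group. -/
def kA : KleinBottleGroup := PresentedGroup.of (0 : Fin 2)

/-- Second generator of the Klein bottle group. -/
def kB : KleinBottleGroup := PresentedGroup.of (1 : Fin 2)

lemma klein_rel : kB * kA * kB⁻¹ * kA = 1 :=
  PresentedGroup.one_of_mem (rels := {FreeGroup.of 1 * FreeGroup.of 0 * (FreeGroup.of 1)⁻¹ *
    FreeGroup.of (0 : Fin 2)}) (Set.mem_singleton _)

lemma klein_conj : kB * kA * kB⁻¹ = kA⁻¹ := eq_inv_of_mul_eq_one_left klein_rel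

lemma klein_lift {H : Type} [Group H] (a b : H) (h : b * a * b⁻¹ = a⁻¹) :
    ∃ φ : KleinBottleGroup →* H, φ kA = a ∧ φ kB = b := by
  have hr : ∀ r ∈ ({FreeGroup.of 1 * FreeGroup.of 0 * (FreeGroup.of 1)⁻¹ * FreeGroup.of 0} :
      Set (FreeGroup (Fin 2))), FreeGroup.lift ![a, b] r = 1 := by
    intro r hr
    rw [Set.mem_singleton_iff] at hr
    subst hr
    simp [h]
  exact ⟨(PresentedGroup.toGroup hr : _ →* H), PresentedGroup.toGroup.of hr,
    PresentedGroup.toGroup.of hr⟩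

lemma klein_closure : Subgroup.closure ({kA, kB} : Set KleinBottleGroup) = ⊤ := by
  have h := PresentedGroup.closure_range_of ({FreeGroup.of 1 * FreeGroup.of 0 *
    (FreeGroup.of 1)⁻¹ * FreeGroup.of 0} : Set (FreeGroup (Fin 2)))
  rw [eq_top_iff]
  intro g _
  have hg : g ∈ (⊤ : Subgroup KleinBottleGroup) := trivial
  have h2 : Subgroup.closure (Set.range (PresentedGroup.of (rels := ({FreeGroup.of 1 *
    FreeGroup.of 0 * (FreeGroup.of 1)⁻¹ * FreeGroup.of 0} : Set (FreeGroup (Fin 2)))))) ≤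
    (Subgroup.closure ({kA, kB} : Set KleinBottleGroup)) := by
    refine (Subgroup.closure_le _).2 ?_
    rintro _ ⟨i, rfl⟩
    fin_cases i
    · exact Subgroup.subset_closure (Or.inl rfl)
    · exact Subgroup.subset_closure (Or.inr rfl)
  exact h2 (h ▸ hg)

lemma conj_zpow_inv {H : Type} [Group H] {a b : H} (h : b * a * b⁻¹ = a⁻¹) (i : ℤ) :
    b * a ^ i = a ^ (-i) * b := by
  have : b * a ^ i * b⁻¹ = a ^ (-i) := by rw [← conj_zpow, h, inv_zpow, zpow_neg]
  rw [← this]; group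

lemma conj_zpow_inv' {H : Type} [Group H] {a b : H} (h : b * a * b⁻¹ = a⁻¹) (i : ℤ) :
    b⁻¹ * a ^ i = a ^ (-i) * b⁻¹ := by
  have h1 := conj_zpow_inv h (-i)
  rw [neg_neg] at h1
  have : b⁻¹ * (b * a ^ (-i)) * b⁻¹ = b⁻¹ * (a ^ i * b) * b⁻¹ := by rw [h1]
  rw [inv_mul_cancel_left] at this
  rw [this]; group

lemma klein_form (g : KleinBottleGroup) : ∃ i j : ℤ, g = kA ^ i * kB ^ j := by
  have hg : g ∈ Subgroup.closure ({kA, kB} : Set KleinBottleGroup) := by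
    rw [klein_closure]; trivial
  induction hg using Subgroup.closure_induction_left with
  | one => exact ⟨0, 0, by simp⟩
  | mul_left x hx y hy ih =>
    obtain ⟨i, j, rfl⟩ := ih
    rcases hx with rfl | rfl
    · exact ⟨i + 1, j, by rw [add_comm i 1, zpow_add, zpow_one, mul_assoc]⟩
    · refine ⟨-i, j + 1, ?_⟩
      rw [← mul_assoc, conj_zpow_inv klein_conj, add_comm j 1, zpow_add, zpow_one, mul_assoc]
  | inv_mul_cancel x hx y hy ih =>
    obtain ⟨i, j, rfl⟩ := ih
    rcases hx with rfl | rfl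
    · exact ⟨i + -1, j, by rw [add_comm i, zpow_add, zpow_neg_one, mul_assoc]⟩
    · refine ⟨-i, j + -1, ?_⟩
      rw [← mul_assoc, conj_zpow_inv' klein_conj, add_comm j, zpow_add, zpow_neg_one, mul_assoc]

lemma klein_iso {H : Type} [Group H] (a b : H) (h : b * a * b⁻¹ = a⁻¹)
    (hs : ∀ g : H, ∃ i j : ℤ, g = a ^ i * b ^ j)
    (hi : ∀ i j : ℤ, a ^ i * b ^ j = 1 → i = 0 ∧ j = 0) : Nonempty (H ≃* KleinBottleGroup) := by
  obtain ⟨φ, ha, hb⟩ := klein_lift a b h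
  refine ⟨(MulEquiv.ofBijective φ ⟨?_, ?_⟩).symm⟩
  · rw [injective_iff_map_eq_one]
    intro g hg
    obtain ⟨i, j, rfl⟩ := klein_form g
    rw [map_mul, map_zpow, map_zpow, ha, hb] at hg
    obtain ⟨rfl, rfl⟩ := hi i j hg
    simp
  · intro g
    obtain ⟨i, j, rfl⟩ := hs g
    exact ⟨kA ^ i * kB ^ j, by rw [map_mul, map_zpow, map_zpow, ha, hb]⟩

lemma zsq_iso {H : Type} [Group H] (a b : H) (h : b * a * b⁻¹ = a)
    (hs : ∀ g : H, ∃ i j : ℤ, g = a ^ i * b ^ j)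
    (hi : ∀ i j : ℤ, a ^ i * b ^ j = 1 → i = 0 ∧ j = 0) :
    Nonempty (H ≃* Multiplicative ℤ × Multiplicative ℤ) := by
  have hc : Commute a b := by
    have : b * a = a * b := by
      conv_rhs => rw [← h]
      group
    exact this.symm
  let φ : Multiplicative ℤ × Multiplicative ℤ →* H :=
    { toFun := fun z => a ^ (z.1.toAdd) * b ^ (z.2.toAdd)
      map_one' := by simp
      map_mul' := by
        intro x y
        simp only [Prod.fst_mul, Prod.snd_mul, toAdd_mul, zpow_add]
        have := (hc.zpow_zpow y.1.toAdd x.2.toAdd).eq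
        simp only [mul_assoc]
        rw [← mul_assoc (b ^ _) (a ^ _), ← this]
        simp only [mul_assoc] }
  refine ⟨(MulEquiv.ofBijective φ ⟨?_, ?_⟩).symm⟩
  · rw [injective_iff_map_eq_one]
    rintro ⟨x, y⟩ hg
    obtain ⟨h1, h2⟩ := hi x.toAdd y.toAdd hg
    ext
    · exact h1
    · exact h2
  · intro g
    obtain ⟨i, j, rfl⟩ := hs g
    exact ⟨(Multiplicative.ofAdd i, Multiplicative.ofAdd j), rfl⟩

lemma kB_zpow (j : ℤ) (h : kB ^ j = 1) : j = 0 := by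
  obtain ⟨φ, h1, h2⟩ := klein_lift (1 : Multiplicative ℤ) (Multiplicative.ofAdd 1) (by simp)
  have := congrArg φ h
  rw [map_zpow, h2, map_one φ, ← ofAdd_zsmul] at this
  have := congrArg Multiplicative.toAdd this
  simpa using this

lemma kA_zpow (j : ℤ) (h : kA ^ j = 1) : j = 0 := by
  obtain ⟨φ, h1, h2⟩ := klein_lift (DihedralGroup.r 1 : DihedralGroup 0) (DihedralGroup.sr 0)
    (by simp)
  have := congrArg φ h
  rw [map_zpow, h1, map_one, DihedralGroup.r_zpow, DihedralGroup.one_def] at this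
  simp only [one_mul, DihedralGroup.r.injEq] at this
  exact this

lemma klein_conv : kA * kB ^ 2 = kB ^ 2 * kA ∧
    (¬ ∃ x : KleinBottleGroup, kA ∈ Subgroup.zpowers x ∧ kB ^ 2 ∈ Subgroup.zpowers x) ∧
    (∀ g : KleinBottleGroup, g * kA * g⁻¹ = kA ∨ g * kA * g⁻¹ = kA⁻¹) ∧
    (∀ g : KleinBottleGroup, g * kB ^ 2 * g⁻¹ = kB ^ 2) := by
  have hcomm : kA * kB ^ 2 = kB ^ 2 * kA := by
    have h1 := conj_zpow_inv klein_conj 1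
    have h2 := conj_zpow_inv klein_conj (-1)
    simp only [zpow_one, neg_neg] at h1 h2
    rw [pow_two, mul_assoc kB kB kA, h1, ← mul_assoc kB (kA ^ _) kB, h2, mul_assoc]
  have hBconj : ∀ j : ℤ, kB ^ j * kA * (kB ^ j)⁻¹ = kA ∨ kB ^ j * kA * (kB ^ j)⁻¹ = kA⁻¹ := by
    intro j
    induction j with
    | zero => left; simp
    | succ n ih =>
      have e : kB ^ ((n : ℤ) + 1) * kA * (kB ^ ((n : ℤ) + 1))⁻¹ =
        kB * (kB ^ (n : ℤ) * kA * (kB ^ (n : ℤ))⁻¹) * kB⁻¹ := by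
        rw [add_comm, zpow_add, zpow_one]; group
      rw [e]
      rcases ih with h | h
      · right; rw [h, klein_conj]
      · left; rw [h, ← conj_inv, klein_conj, inv_inv]
    | pred n ih =>
      have e : kB ^ (-(n : ℤ) - 1) * kA * (kB ^ (-(n : ℤ) - 1))⁻¹ =
        kB⁻¹ * (kB ^ (-(n : ℤ)) * kA * (kB ^ (-(n : ℤ)))⁻¹) * kB := by
        rw [sub_eq_add_neg, add_comm, zpow_add, zpow_neg_one]; group
      have e2 : kB⁻¹ * kA * kB = kA⁻¹ := by
        have := conj_zpow_inv' klein_conj 1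
        simp only [zpow_one, zpow_neg] at this
        rw [this]; group
      rw [e]
      rcases ih with h | h
      · right; rw [h, e2]
      · left; rw [h]
        have : kB⁻¹ * kA⁻¹ * kB = (kB⁻¹ * kA * kB)⁻¹ := by group
        rw [this, e2, inv_inv]
  refine ⟨hcomm, ?_, ?_, ?_⟩
  · rintro ⟨x, ⟨p, hp⟩, ⟨q, hq⟩⟩
    simp only at hp hq
    have h1 : kA ^ q = kB ^ (2 * p) := by
      have : (kB ^ 2) ^ p = kA ^ q := by
        rw [← hp, ← hq, ← zpow_mul, ← zpow_mul, mul_comm]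
      rw [← this, zpow_mul]
      norm_cast
    have h2 : kA ^ (-q) = kA ^ q := by
      have := conj_zpow_inv klein_conj q
      rw [h1] at this
      have e : kB * kB ^ (2 * p) = kB ^ (2 * p) * kB := (Commute.self_zpow kB _).eq
      rw [e] at this
      rw [h1]
      exact (mul_right_cancel this).symm
    have h3 : kA ^ (q + q) = 1 := by
      rw [zpow_add]
      nth_rewrite 1 [← h2]
      rw [← zpow_add]; simp
    have h4 := kA_zpow _ h3
    have h5 : q = 0 := by omega
    rw [h5, zpow_zero] at hq
    have := kB_zpow 2 (by rw [hq]; norm_cast)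
    omega
  · intro g
    obtain ⟨i, j, rfl⟩ := klein_form g
    have e : kA ^ i * kB ^ j * kA * (kA ^ i * kB ^ j)⁻¹ =
      kA ^ i * (kB ^ j * kA * (kB ^ j)⁻¹) * (kA ^ i)⁻¹ := by group
    rw [e]
    rcases hBconj j with h | h
    · left; rw [h]; group
    · right; rw [h]; group
  · intro g
    obtain ⟨i, j, rfl⟩ := klein_form g
    have c1 : Commute (kA ^ i) (kB ^ 2) := Commute.zpow_left hcomm i
    have c2 : Commute (kB ^ j) (kB ^ 2) := by
      have := (Commute.refl kB).zpow_zpow j 2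
      exact_mod_cast this
    have := (c1.mul_left c2).eq
    rw [this]; group

lemma zsq_conv : ¬ ∃ x : Multiplicative ℤ × Multiplicative ℤ,
    (Multiplicative.ofAdd 1, 1) ∈ Subgroup.zpowers x ∧
    (1, Multiplicative.ofAdd 1) ∈ Subgroup.zpowers x := by
  rintro ⟨⟨x, y⟩, ⟨p, hp⟩, ⟨q, hq⟩⟩
  have h1 : p * x.toAdd = 1 := congrArg (fun z => z.1.toAdd) hp
  have h2 : p * y.toAdd = 0 := congrArg (fun z => z.2.toAdd) hp
  have h3 : q * x.toAdd = 0 := congrArg (fun z => z.1.toAdd) hq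
  have h4 : q * y.toAdd = 1 := congrArg (fun z => z.2.toAdd) hq
  have : (p * x.toAdd) * (q * y.toAdd) = (p * y.toAdd) * (q * x.toAdd) := by ring
  rw [h1, h2, h3, h4] at this
  norm_num at this

lemma converse_main {G V : Type} [Group G]
    (X : SimpleGraph V) (ρ : G →* Equiv.Perm V) (hX : IsGBSTree X ρ)
    (h : Nonempty (G ≃* Multiplicative ℤ × Multiplicative ℤ) ∨
        Nonempty (G ≃* KleinBottleGroup)) :
    ∃ L : Set V, IsLine X L ∧ ∀ g : G, ⇑(ρ g) '' L = L := by
  have tr : ∀ {H : Type} [Group H] (e : G ≃* H) (a c : H), a * c = c * a →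
      (¬ ∃ x : H, a ∈ Subgroup.zpowers x ∧ c ∈ Subgroup.zpowers x) →
      (∀ g : H, g * a * g⁻¹ = a ∨ g * a * g⁻¹ = a⁻¹) →
      (∀ g : H, g * c * g⁻¹ = c ∨ g * c * g⁻¹ = c⁻¹) →
      ∃ L : Set V, IsLine X L ∧ ∀ g : G, ⇑(ρ g) '' L = L := by
    intro H _ e a c h1 h2 h3 h4
    refine converse_line hX (e.symm a) (e.symm c) (by rw [← map_mul, h1, map_mul]) ?_ ?_ ?_
    · rintro ⟨x, ⟨p, hp⟩, ⟨q, hq⟩⟩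
      refine h2 ⟨e x, ⟨p, ?_⟩, ⟨q, ?_⟩⟩
      · simpa using congrArg e hp
      · simpa using congrArg e hq
    · intro g
      refine (h3 (e g)).imp (fun h => ?_) (fun h => ?_)
      · simpa using congrArg e.symm h
      · simpa using congrArg e.symm h
    · intro g
      refine (h4 (e g)).imp (fun h => ?_) (fun h => ?_)
      · simpa using congrArg e.symm h
      · simpa using congrArg e.symm h
  rcases h with ⟨⟨e⟩⟩ | ⟨⟨e⟩⟩
  · exact tr e _ _ (mul_comm _ _) zsq_conv (fun g => Or.inl (by rw [mul_comm g]; simp))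
      (fun g => Or.inl (by rw [mul_comm g]; simp))
  · obtain ⟨h1, h2, h3, h4⟩ := klein_conv
    exact tr e _ _ h1 h2 h3 (fun g => Or.inl (h4 g))

end KleinLemmas

section Forward

variable {G V : Type} [Group G] {X : SimpleGraph V} {ρ : G →* Equiv.Perm V} {f : ℤ → V}

/-- `g` translates the line `f` by `c`. -/
def Tr (ρ : G →* Equiv.Perm V) (f : ℤ → V) (g : G) (c : ℤ) : Prop := ∀ n, ρ g (f n) = f (n + c)

/-- `g` reflects the line `f`. -/
def Rf (ρ : G →* Equiv.Perm V) (f : ℤ → V) (g : G) (c : ℤ) : Prop := ∀ n, ρ g (f n) = f (c - n)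

lemma Tr.mul {g h : G} {c d : ℤ} (hg : Tr ρ f g c) (hh : Tr ρ f h d) : Tr ρ f (g * h) (c + d) := by
  intro n
  rw [map_mul, Equiv.Perm.mul_apply, hh, hg]
  congr 1; ring

lemma Tr.inv {g : G} {c : ℤ} (hg : Tr ρ f g c) : Tr ρ f g⁻¹ (-c) := by
  intro n
  rw [map_inv, Equiv.Perm.inv_eq_iff_eq, hg]
  congr 1; ring

lemma Tr.one : Tr ρ f (1 : G) 0 := by
  intro n
  simp

lemma Tr.zpow {g : G} {c : ℤ} (hg : Tr ρ f g c) (i : ℤ) : Tr ρ f (g ^ i) (i * c) := by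
  induction i with
  | zero => simpa using Tr.one
  | succ n ih =>
    have := ih.mul hg
    rw [zpow_add, zpow_one]
    convert this using 1; ring
  | pred n ih =>
    have := ih.mul hg.inv
    rw [sub_eq_add_neg, zpow_add, zpow_neg_one]
    convert this using 1; ring

lemma Rf.mul {g h : G} {c d : ℤ} (hg : Rf ρ f g c) (hh : Rf ρ f h d) : Tr ρ f (g * h) (c - d) := by
  intro n
  rw [map_mul, Equiv.Perm.mul_apply, hh, hg]
  congr 1; ring

lemma Tr.mul_Rf {g h : G} {c d : ℤ} (hg : Tr ρ f g c) (hh : Rf ρ f h d) :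
    Rf ρ f (g * h) (d + c) := by
  intro n
  rw [map_mul, Equiv.Perm.mul_apply, hh, hg]
  congr 1; ring

lemma Rf.inv {g : G} {c : ℤ} (hg : Rf ρ f g c) : Rf ρ f g⁻¹ c := by
  intro n
  rw [map_inv, Equiv.Perm.inv_eq_iff_eq, hg]
  congr 1; ring

lemma Tr.unique (hinj : Function.Injective f) {g : G} {c d : ℤ} (h1 : Tr ρ f g c)
    (h2 : Tr ρ f g d) : c = d := by
  have := hinj ((h1 0).symm.trans (h2 0))
  omega

lemma Tr.not_Rf (hinj : Function.Injective f) {g : G} {c d : ℤ} (h1 : Tr ρ f g c)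
    (h2 : Rf ρ f g d) : False := by
  have a := hinj ((h1 0).symm.trans (h2 0))
  have b := hinj ((h1 1).symm.trans (h2 1))
  omega

lemma tr_or_rf (hT : X.IsTree) (hρ : PreservesAdj X ρ)
    (hadj : ∀ n : ℤ, X.Adj (f n) (f (n + 1))) (hinj : Function.Injective f)
    (hinv : ∀ g : G, ⇑(ρ g) '' (Set.range f) = Set.range f) (g : G) :
    (∃ c, Tr ρ f g c) ∨ (∃ c, Rf ρ f g c) := by
  have hex : ∀ n, ∃ m, ρ g (f n) = f m := by
    intro n
    have : ρ g (f n) ∈ Set.range f := by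
      rw [← hinv g]
      exact ⟨f n, ⟨n, rfl⟩, rfl⟩
    obtain ⟨m, hm⟩ := this
    exact ⟨m, hm.symm⟩
  choose φ hφ using hex
  have hφinj : Function.Injective φ := by
    intro a b h
    apply hinj
    apply (ρ g).injective
    rw [hφ, hφ, h]
  have hstep : ∀ n, φ (n + 1) = φ n + 1 ∨ φ (n + 1) = φ n - 1 := by
    intro n
    apply line_adj hT f hadj hinj
    rw [← hφ, ← hφ]
    exact hρ g _ _ (hadj n)
  have hconst : ∀ n, φ (n + 1) - φ n = φ (n + 1 + 1) - φ (n + 1) := by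
    intro n
    have h1 := hstep n
    have h2 := hstep (n + 1)
    have h3 : φ (n + 1 + 1) ≠ φ n := fun h => by
      have := hφinj h
      omega
    omega
  have hall : ∀ n, φ (n + 1) - φ n = φ 1 - φ 0 := by
    intro n
    induction n with
    | zero => simp
    | succ n ih => rw [← hconst, ih]
    | pred n ih =>
      have := hconst (-(n : ℤ) - 1)
      rw [sub_add_cancel] at this
      rw [sub_add_cancel]
      omega
  have hlin : ∀ n, φ n = φ 0 + n * (φ 1 - φ 0) := by
    intro n
    induction n with
    | zero => simp
    | succ n ih =>
      have := hall n
      linear_combination ih + this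
    | pred n ih =>
      have := hall (-(n : ℤ) - 1)
      rw [sub_add_cancel] at this
      linear_combination ih - this
  have h0 := hstep 0
  rw [zero_add] at h0
  rcases h0 with h | h
  · left
    refine ⟨φ 0, fun n => ?_⟩
    rw [hφ, hlin n, h]
    congr 1; ring
  · right
    refine ⟨φ 0, fun n => ?_⟩
    rw [hφ, hlin n, h]
    congr 1; ring

lemma infCyclic_gen {H : Subgroup G} (hH : IsInfCyclic H) :
    ∃ k : G, (∀ g, g ∈ H ↔ ∃ i : ℤ, g = k ^ i) ∧ (∀ i : ℤ, k ^ i = 1 → i = 0) := by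
  obtain ⟨h1, h2⟩ := hH
  obtain ⟨x, hx⟩ := h1.exists_generator
  refine ⟨x, fun g => ⟨fun hg => ?_, ?_⟩, ?_⟩
  · obtain ⟨i, hi⟩ := hx ⟨g, hg⟩
    exact ⟨i, by simpa using (congrArg Subtype.val hi).symm⟩
  · rintro ⟨i, rfl⟩
    exact H.zpow_mem x.2 i
  · intro i hi
    have h3 := Infinite.orderOf_eq_zero_of_forall_mem_zpowers hx
    have h4 : x ^ i = 1 := by
      ext
      simpa using hi
    have := orderOf_dvd_iff_zpow_eq_one.2 h4
    rw [h3] at this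
    simpa using this

lemma int_iso_of {H : Subgroup G} (hH : IsInfCyclic H) (htop : ∀ g, g ∈ H) :
    Nonempty (G ≃* Multiplicative ℤ) := by
  obtain ⟨k, h1, h2⟩ := infCyclic_gen hH
  refine ⟨(MulEquiv.ofBijective (zpowersHom G k) ⟨?_, ?_⟩).symm⟩
  · rw [injective_iff_map_eq_one]
    intro z hz
    exact h2 z.toAdd (by simpa using hz)
  · intro g
    obtain ⟨i, hi⟩ := (h1 g).1 (htop g)
    exact ⟨Multiplicative.ofAdd i, by simp [hi]⟩

lemma rf_even (hni : NoInversions X ρ) (hadj : ∀ n : ℤ, X.Adj (f n) (f (n + 1)))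
    {s : G} {c : ℤ} (hs : Rf ρ f s c) : ∃ e, c = 2 * e := by
  rcases Int.even_or_odd' c with ⟨e, h | h⟩
  · exact ⟨e, h⟩
  · exfalso
    refine hni s (f e) (f (e + 1)) (hadj e) ⟨?_, ?_⟩
    · rw [hs]; congr 1; omega
    · rw [hs]; congr 1; omega

lemma rf_gen (hX : IsGBSTree X ρ) (hadj : ∀ n : ℤ, X.Adj (f n) (f (n + 1)))
    (hinj : Function.Injective f) (htr : ∀ g : G, (∃ c, Tr ρ f g c) ∨ (∃ c, Rf ρ f g c))
    {s : G} {c : ℤ} (hs : Rf ρ f s c) :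
    ∃ x, Rf ρ f x c ∧ (∀ g, Tr ρ f g 0 → ∃ i : ℤ, g = (x ^ 2) ^ i) ∧
      (∀ i : ℤ, x ^ i = 1 → i = 0) := by
  obtain ⟨⟨hT, hρ, hni⟩, hv, -⟩ := hX
  obtain ⟨e, rfl⟩ := rf_even hni hadj hs
  obtain ⟨x, hx1, hx2⟩ := infCyclic_gen (hv (f e))
  have hxe : ρ x (f e) = f e := (hx1 x).2 ⟨1, by simp⟩
  obtain ⟨j, hj⟩ := (hx1 s).1 (by
    change ρ s (f e) = f e
    rw [hs]; congr 1; ring)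
  have hxR : Rf ρ f x (2 * e) := by
    rcases htr x with ⟨d, hd⟩ | ⟨d, hd⟩
    · exfalso
      have := hd.zpow j
      rw [← hj] at this
      exact this.not_Rf hinj hs
    · have h := hinj ((hd e).symm.trans hxe)
      have : d = 2 * e := by omega
      rwa [this] at hd
  have hx20 : Tr ρ f (x ^ 2) 0 := by
    have := hxR.mul hxR
    rwa [sub_self, ← pow_two] at this
  refine ⟨x, hxR, ?_, hx2⟩
  intro g hg
  obtain ⟨i, hi⟩ := (hx1 g).1 (by
    change ρ g (f e) = f e
    rw [hg, add_zero])
  rcases Int.even_or_odd' i with ⟨l, h | h⟩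
  · refine ⟨l, ?_⟩
    rw [hi, h, zpow_mul]
    norm_cast
  · exfalso
    have h1 := (hx20.zpow l).mul_Rf hxR
    have h2 : g = (x ^ 2) ^ l * x := by
      rw [hi, h, zpow_add, zpow_mul, zpow_one]
      norm_cast
    rw [← h2] at h1
    exact hg.not_Rf hinj h1

lemma unit_exp {k : G} (hk : ∀ i : ℤ, k ^ i = 1 → i = 0) {i j : ℤ} (h : k = (k ^ i) ^ j) :
    i = 1 ∨ i = -1 := by
  rw [← zpow_mul] at h
  have h2 : k ^ (i * j - 1) = 1 := by
    rw [zpow_sub, ← h, zpow_one, mul_inv_cancel]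
  have h3 := hk _ h2
  exact Int.isUnit_iff.1 (IsUnit.of_mul_eq_one j (by omega))

lemma forward_main (hX : IsGBSTree X ρ) (hZ : ¬ Nonempty (G ≃* Multiplicative ℤ))
    (hadj : ∀ n : ℤ, X.Adj (f n) (f (n + 1))) (hinj : Function.Injective f)
    (hinv : ∀ g : G, ⇑(ρ g) '' (Set.range f) = Set.range f) :
    Nonempty (G ≃* Multiplicative ℤ × Multiplicative ℤ) ∨
        Nonempty (G ≃* KleinBottleGroup) := by
  have htr := tr_or_rf hX.1.1 hX.1.2.1 hadj hinj hinv
  have hGBS := hX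
  obtain ⟨⟨hT, hρ, hni⟩, hv, he⟩ := hGBS
  -- the kernel
  have hK : ∀ g, g ∈ eStab ρ (f 0) (f 1) ↔ Tr ρ f g 0 := by
    intro g
    constructor
    · rintro ⟨h0, h1⟩
      have h0 : ρ g (f 0) = f 0 := h0
      have h1 : ρ g (f 1) = f 1 := h1
      rcases htr g with ⟨d, hd⟩ | ⟨d, hd⟩
      · have h := hinj ((hd 0).symm.trans h0)
        have : d = 0 := by omega
        rwa [this] at hd
      · exfalso
        have a := hinj ((hd 0).symm.trans h0)
        have b := hinj ((hd 1).symm.trans h1)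
        omega
    · intro h
      refine ⟨?_, ?_⟩
      · change ρ g (f 0) = f 0
        rw [h, add_zero]
      · change ρ g (f 1) = f 1
        rw [h, add_zero]
  have heI : IsInfCyclic (eStab ρ (f 0) (f 1)) := he _ _ (by simpa using hadj 0)
  obtain ⟨k, hk1, hk2⟩ := infCyclic_gen heI
  have hkT : Tr ρ f k 0 := (hK k).1 ((hk1 k).2 ⟨1, by simp⟩)
  have hkT' : ∀ g, Tr ρ f g 0 → ∃ i : ℤ, g = k ^ i := fun g hg => (hk1 g).1 ((hK g).2 hg)
  -- translation lengths
  obtain ⟨t, m, htm, hm⟩ : ∃ (t : G) (m : ℤ), Tr ρ f t m ∧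
      ∀ g c, Tr ρ f g c → ∃ q : ℤ, c = q * m := by
    let S : AddSubgroup ℤ :=
      { carrier := {c | ∃ g, Tr ρ f g c}
        zero_mem' := ⟨1, Tr.one⟩
        add_mem' := by
          rintro a b ⟨g, hg⟩ ⟨h, hh⟩
          exact ⟨g * h, hg.mul hh⟩
        neg_mem' := by
          rintro a ⟨g, hg⟩
          exact ⟨g⁻¹, hg.inv⟩ }
    obtain ⟨m, hm⟩ := Int.subgroup_cyclic S
    have hmS : m ∈ S := by
      rw [hm]; exact AddSubgroup.subset_closure rfl
    obtain ⟨t, ht⟩ := hmS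
    refine ⟨t, m, ht, ?_⟩
    intro g c hg
    have hc : c ∈ S := ⟨g, hg⟩
    rw [hm, AddSubgroup.mem_closure_singleton] at hc
    obtain ⟨q, hq⟩ := hc
    exact ⟨q, by rw [← hq, smul_eq_mul]⟩
  by_cases hR : ∃ s c, Rf ρ f s c
  · obtain ⟨s, c, hs⟩ := hR
    obtain ⟨e, hce⟩ := rf_even hni hadj hs
    have hm0 : m ≠ 0 := by
      intro hm0
      apply hZ
      apply int_iso_of (hv (f e))
      have hzero : ∀ g c, Tr ρ f g c → c = 0 := by
        intro g c hg
        obtain ⟨q, hq⟩ := hm g c hg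
        rw [hq, hm0, mul_zero]
      intro g
      change ρ g (f e) = f e
      rcases htr g with ⟨d, hd⟩ | ⟨d, hd⟩
      · rw [hd, hzero g d hd, add_zero]
      · have := hzero _ _ (hd.mul hs)
        rw [hd]; congr 1; omega
    obtain ⟨x, hxR, hx1, hx2⟩ := rf_gen hX hadj hinj htr hs
    obtain ⟨y0, hyR0, hy1, hy2⟩ := rf_gen hX hadj hinj htr (htm.mul_Rf hs)
    have hx20 : Tr ρ f (x ^ 2) 0 := by
      have := hxR.mul hxR
      rwa [sub_self, ← pow_two] at this
    have hy20 : Tr ρ f (y0 ^ 2) 0 := by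
      have := hyR0.mul hyR0
      rwa [sub_self, ← pow_two] at this
    obtain ⟨y, hyR, hyx⟩ : ∃ y, Rf ρ f y (c + m) ∧ y ^ 2 = x ^ 2 := by
      obtain ⟨i, hi⟩ := hx1 _ hy20
      obtain ⟨j, hj⟩ := hy1 _ hx20
      have hx2' : ∀ i : ℤ, (x ^ 2) ^ i = 1 → i = 0 := by
        intro i hi
        have : x ^ (2 * i) = 1 := by
          rw [zpow_mul]; exact_mod_cast hi
        have := hx2 _ this
        omega
      rcases unit_exp hx2' (i := i) (j := j) (by rw [← hi, ← hj]) with h | h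
      · refine ⟨y0, hyR0, ?_⟩
        rw [hi, h, zpow_one]
      · refine ⟨y0⁻¹, hyR0.inv, ?_⟩
        rw [inv_pow, hi, h, zpow_neg_one, inv_inv]
    right
    have haT : Tr ρ f (y * x⁻¹) m := by
      have := hyR.mul hxR.inv
      convert this using 1; ring
    have hform : ∀ g d, Tr ρ f g d → ∃ q i : ℤ, g = (y * x⁻¹) ^ q * x ^ (2 * i) := by
      intro g d hg
      obtain ⟨q, hq⟩ := hm g d hg
      have h1 := (haT.zpow (-q)).mul hg
      have e0 : -q * m + d = 0 := by rw [hq]; ring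
      rw [e0] at h1
      obtain ⟨i, hi⟩ := hx1 _ h1
      refine ⟨q, i, ?_⟩
      have e1 : x ^ (2 * i) = (x ^ 2) ^ i := by
        rw [zpow_mul]; norm_cast
      rw [e1, ← hi]
      group
    refine klein_iso (y * x⁻¹) x ?_ ?_ ?_
    · have : x * (y * x⁻¹) * x⁻¹ = x * y * (x ^ 2)⁻¹ := by rw [pow_two]; group
      rw [this, ← hyx, pow_two]
      group
    · intro g
      rcases htr g with ⟨d, hd⟩ | ⟨d, hd⟩
      · obtain ⟨q, i, h⟩ := hform g d hd
        exact ⟨q, 2 * i, h⟩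
      · obtain ⟨q, i, h⟩ := hform _ _ (hd.mul hxR.inv)
        refine ⟨q, 2 * i + 1, ?_⟩
        rw [zpow_add, zpow_one, ← mul_assoc, ← h]
        group
    · intro i j hij
      rcases Int.even_or_odd' j with ⟨l, h | h⟩
      · have h1 := (haT.zpow i).mul (hx20.zpow l)
        have e1 : x ^ j = (x ^ 2) ^ l := by
          rw [h, zpow_mul]; norm_cast
        rw [← e1, hij] at h1
        have h2 := h1.unique hinj Tr.one
        have hi0 : i = 0 := by
          have : i * m = 0 := by linarith
          exact (mul_eq_zero.1 this).resolve_right hm0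
        refine ⟨hi0, hx2 j ?_⟩
        rw [hi0, zpow_zero, one_mul] at hij
        exact hij
      · exfalso
        have h1 := (haT.zpow i).mul_Rf ((hx20.zpow l).mul_Rf hxR)
        have e1 : x ^ j = (x ^ 2) ^ l * x := by
          rw [h, zpow_add, zpow_mul, zpow_one]; norm_cast
        rw [← e1, hij] at h1
        exact Tr.one.not_Rf hinj h1
  · have hall : ∀ g, ∃ c, Tr ρ f g c := by
      intro g
      rcases htr g with h | ⟨c, h⟩
      · exact h
      · exact absurd ⟨g, c, h⟩ hR
    have hm0 : m ≠ 0 := by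
      intro hm0
      apply hZ
      apply int_iso_of heI
      intro g
      rw [hK]
      obtain ⟨c, hc⟩ := hall g
      obtain ⟨q, hq⟩ := hm g c hc
      rw [hm0, mul_zero] at hq
      rwa [hq] at hc
    have hs : ∀ g : G, ∃ i j : ℤ, g = k ^ i * t ^ j := by
      intro g
      obtain ⟨c, hc⟩ := hall g
      obtain ⟨q, hq⟩ := hm g c hc
      have h1 := hc.mul (htm.zpow (-q))
      have e0 : c + -q * m = 0 := by rw [hq]; ring
      rw [e0] at h1
      obtain ⟨i, hi⟩ := hkT' _ h1
      refine ⟨i, q, ?_⟩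
      rw [← hi]; group
    have hi : ∀ i j : ℤ, k ^ i * t ^ j = 1 → i = 0 ∧ j = 0 := by
      intro i j hij
      have h1 := (hkT.zpow i).mul (htm.zpow j)
      rw [hij] at h1
      have h2 := h1.unique hinj Tr.one
      have hj0 : j = 0 := by
        have : j * m = 0 := by linarith
        exact (mul_eq_zero.1 this).resolve_right hm0
      rw [hj0, zpow_zero, mul_one] at hij
      exact ⟨hk2 i hij, hj0⟩
    have c1 : Tr ρ f (t * k * t⁻¹) 0 := by
      have := (htm.mul hkT).mul htm.inv
      convert this using 1; ring
    have c2 : Tr ρ f (t⁻¹ * k * t) 0 := by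
      have := (htm.inv.mul hkT).mul htm
      convert this using 1; ring
    obtain ⟨i, h1⟩ := hkT' _ c1
    obtain ⟨j, h2⟩ := hkT' _ c2
    have h3 : k = (k ^ i) ^ j := by
      rw [← h1, conj_zpow, ← h2]; group
    rcases unit_exp hk2 h3 with h | h
    · left
      rw [h, zpow_one] at h1
      exact zsq_iso k t h1 hs hi
    · right
      rw [h, zpow_neg_one] at h1
      exact klein_iso k t h1 hs hi

end Forward

/-- A generalized Baumslag–Solitar tree with group `G ≇ ℤ`
contains a `G`-invariant line iff `G` is isomorphic to `ℤ × ℤ` or to the Klein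
bottle group. -/
theorem gbs_invariant_line_iff {G V : Type} [Group G]
    (X : SimpleGraph V) (ρ : G →* Equiv.Perm V) (hX : IsGBSTree X ρ)
    (hZ : ¬ Nonempty (G ≃* Multiplicative ℤ)) :
    (∃ L : Set V, IsLine X L ∧ ∀ g : G, ⇑(ρ g) '' L = L) ↔
      (Nonempty (G ≃* Multiplicative ℤ × Multiplicative ℤ) ∨
        Nonempty (G ≃* KleinBottleGroup)) := by
  constructor
  · rintro ⟨L, ⟨f, hinj, hadj, rfl⟩, hinv⟩
    exact forward_main hX hZ hadj hinj hinv
  · exact converse_main X ρ hX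
end

section
/- Let X be a generalized Baumslag–Solitar tree with group G. Then every subgroup H of G is either a generalized Baumslag–Solitar group or a free group, and the only group which is both is ℤ. -/
open SimpleGraph

section CyclicStabilizers

variable {G V : Type} [Group G]

lemma mem_vStab (ρ : G →* Equiv.Perm V) (v : V) (g : G) : g ∈ vStab ρ v ↔ ρ g v = v := Iff.rfl

lemma IsInfCyclic.exists_gen {K : Subgroup G} (hK : IsInfCyclic K) :
    ∃ t ∈ K, (∀ a ∈ K, ∃ k : ℤ, t ^ k = a) ∧ (∀ k : ℤ, t ^ k = 1 → k = 0) := by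
  obtain ⟨⟨⟨t, ht⟩, hgen⟩, hinf⟩ := hK
  refine ⟨t, ht, ?_, ?_⟩
  · intro a ha
    obtain ⟨k, hk⟩ := hgen ⟨a, ha⟩
    exact ⟨k, by simpa using congrArg Subtype.val hk⟩
  · intro k hk
    by_contra h0
    have hfin : IsOfFinOrder (⟨t, ht⟩ : K) :=
      isOfFinOrder_iff_zpow_eq_one.2 ⟨k, h0, by ext; simpa using hk⟩
    have h1 : (Subgroup.zpowers (⟨t, ht⟩ : K) : Set K).Finite := by
      rw [← finite_zpowers] at hfin; exact hfin
    have h2 : (Subgroup.zpowers (⟨t, ht⟩ : K) : Set K) = Set.univ := by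
      ext x; exact ⟨fun _ => trivial, fun _ => hgen x⟩
    rw [h2] at h1
    exact Set.infinite_univ h1

lemma IsInfCyclic.pow_ne_one {K : Subgroup G} (hK : IsInfCyclic K) {a : G} (ha : a ∈ K)
    (h1 : a ≠ 1) {n : ℤ} (hn : n ≠ 0) : a ^ n ≠ 1 := by
  obtain ⟨t, -, hg, h0⟩ := hK.exists_gen
  obtain ⟨k, rfl⟩ := hg a ha
  intro h
  rw [← zpow_mul] at h
  have := h0 _ h
  rcases mul_eq_zero.1 this with h | h
  · subst h; simp at h1
  · exact hn h

lemma IsInfCyclic.exists_pow_eq {K : Subgroup G} (hK : IsInfCyclic K) {a b : G} (ha : a ∈ K)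
    (hb : b ∈ K) (ha1 : a ≠ 1) (hb1 : b ≠ 1) : ∃ i j : ℤ, i ≠ 0 ∧ j ≠ 0 ∧ a ^ i = b ^ j := by
  obtain ⟨t, -, hg, h0⟩ := hK.exists_gen
  obtain ⟨k, rfl⟩ := hg a ha
  obtain ⟨l, rfl⟩ := hg b hb
  refine ⟨l, k, ?_, ?_, ?_⟩
  · rintro rfl; simp at hb1
  · rintro rfl; simp at ha1
  · rw [← zpow_mul, ← zpow_mul, mul_comm]

lemma IsInfCyclic.exists_ne_one {K : Subgroup G} (hK : IsInfCyclic K) : ∃ a ∈ K, a ≠ 1 := by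
  obtain ⟨t, ht, hg, h0⟩ := hK.exists_gen
  refine ⟨t, ht, ?_⟩
  rintro rfl
  have := h0 1 (by simp)
  omega

lemma IsInfCyclic.subgroupOf {K : Subgroup G} (hK : IsInfCyclic K) (H : Subgroup G) {a : G}
    (haH : a ∈ H) (haK : a ∈ K) (h1 : a ≠ 1) : IsInfCyclic (K.comap H.subtype) := by
  constructor
  · have := hK.1
    let f : (K.comap H.subtype) →* K :=
      { toFun := fun x => ⟨x.1.1, x.2⟩
        map_one' := rfl
        map_mul' := fun _ _ => rfl }
    exact isCyclic_of_injective f (fun x y h => by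
      have := congrArg Subtype.val h
      exact Subtype.ext (Subtype.ext this))
  · have hmem : ∀ n : ℤ, (⟨a, haH⟩ : H) ^ n ∈ K.comap H.subtype := by
      intro n
      exact Subgroup.zpow_mem _ (show a ∈ K from haK) n
    refine Infinite.of_injective (fun n : ℤ => (⟨_, hmem n⟩ : K.comap H.subtype)) ?_
    intro m n hmn
    have h2 : a ^ m = a ^ n := by
      simpa using congrArg (fun x => ((x : K.comap H.subtype) : H).1) hmn
    by_contra hne
    refine hK.pow_ne_one haK h1 (sub_ne_zero.2 hne) ?_
    rw [zpow_sub, h2, mul_inv_cancel]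

lemma IsGBSTree.pow_mem {X : SimpleGraph V} {ρ : G →* Equiv.Perm V} (hX : IsGBSTree X ρ)
    (u v : V) : ∀ a ∈ vStab ρ u, a ≠ 1 → ∃ n : ℤ, n ≠ 0 ∧ a ^ n ∈ vStab ρ v := by
  obtain ⟨w⟩ := hX.1.1.connected.preconnected u v
  induction w with
  | nil => intro a ha _; exact ⟨1, one_ne_zero, by simpa using ha⟩
  | @cons u w v huw p ih =>
    intro a ha h1
    obtain ⟨e, he, he1⟩ := (hX.2.2 u w huw).exists_ne_one
    obtain ⟨i, j, hi, hj, hij⟩ := (hX.2.1 u).exists_pow_eq ha he.1 h1 he1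
    have hm : a ^ i ∈ vStab ρ w := by rw [hij]; exact Subgroup.zpow_mem _ he.2 j
    obtain ⟨n, hn, hmem⟩ := ih (a ^ i) hm ((hX.2.1 u).pow_ne_one ha h1 hi)
    exact ⟨i * n, mul_ne_zero hi hn, by rwa [zpow_mul]⟩

lemma IsGBSTree.subgroup {X : SimpleGraph V} {ρ : G →* Equiv.Perm V} (hX : IsGBSTree X ρ)
    (H : Subgroup G) {a : G} (haH : a ∈ H) (v : V) (hv : ρ a v = v) (h1 : a ≠ 1) :
    IsGBSTree X (ρ.comp H.subtype) := by
  refine ⟨⟨hX.1.1, fun g => hX.1.2.1 g, fun g => hX.1.2.2 g⟩, ?_, ?_⟩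
  · intro u
    obtain ⟨n, hn, hm⟩ := hX.pow_mem v u a hv h1
    exact (hX.2.1 u).subgroupOf H (H.zpow_mem haH n) hm ((hX.2.1 v).pow_ne_one hv h1 hn)
  · intro u w huw
    obtain ⟨n, hn, hm⟩ := hX.pow_mem v u a hv h1
    have h2 := (hX.2.1 v).pow_ne_one hv h1 hn
    obtain ⟨k, hk, hm'⟩ := hX.pow_mem u w _ hm h2
    exact (hX.2.2 u w huw).subgroupOf H (H.zpow_mem (H.zpow_mem haH n) k)
      ⟨Subgroup.zpow_mem _ hm k, hm'⟩ ((hX.2.1 u).pow_ne_one hm h2 hk)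

lemma IsGBSTree.exists_commensurated {X : SimpleGraph V} {ρ : G →* Equiv.Perm V}
    (hX : IsGBSTree X ρ) : ∃ a : G, a ≠ 1 ∧
      ∀ g : G, ∃ m n : ℤ, m ≠ 0 ∧ n ≠ 0 ∧ g * a ^ m * g⁻¹ = a ^ n := by
  obtain ⟨v⟩ := hX.1.1.connected.nonempty
  obtain ⟨a, ha, h1⟩ := (hX.2.1 v).exists_ne_one
  refine ⟨a, h1, fun g => ?_⟩
  obtain ⟨n, hn, hm⟩ := hX.pow_mem v (ρ g v) a ha h1
  have hc : g * a * g⁻¹ ∈ vStab ρ (ρ g v) := by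
    rw [mem_vStab] at ha ⊢
    simp [ha]
  have hc1 : g * a * g⁻¹ ≠ 1 := by
    intro h; exact h1 (by simpa using h)
  obtain ⟨i, j, hi, hj, hij⟩ := (hX.2.1 _).exists_pow_eq hc hm hc1
    ((hX.2.1 v).pow_ne_one ha h1 hn)
  exact ⟨i, n * j, hi, mul_ne_zero hn hj, by rw [← conj_zpow, hij, zpow_mul]⟩

end CyclicStabilizers

section FreeGroupCommensurator

open FreeGroup

variable {α : Type} 

lemma cyc_toWord_pow [DecidableEq α] {C : List (α × Bool)} (hC : IsCyclicallyReduced C) (n : ℕ) :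
    (mk C ^ n : FreeGroup α).toWord = (List.replicate n C).flatten := by
  rw [pow_mk, toWord_mk]
  exact (hC.flatten_replicate n).isReduced.reduce_eq

lemma exists_letter {x y : α} (hxy : x ≠ y) (s t : α × Bool) :
    ∃ z : α × Bool, (z.1 = s.1 → z.2 = s.2) ∧ z ≠ t := by
  by_cases h1 : s.1 = x
  · by_cases h2 : t = (y, true)
    · exact ⟨(y, false), by grind, by grind⟩
    · exact ⟨(y, true), by grind, by grind⟩
  · by_cases h2 : t = (x, true)
    · exact ⟨(x, false), by grind, by grind⟩
    · exact ⟨(x, true), by grind, by grind⟩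

lemma not_conj_pow_cyc {x y : α} (hxy : x ≠ y) (C : List (α × Bool)) (hC : IsCyclicallyReduced C)
    (hne : C ≠ []) (h : ∀ g : FreeGroup α, ∃ m n : ℤ, m ≠ 0 ∧ n ≠ 0 ∧
      g * mk C ^ m * g⁻¹ = mk C ^ n) : False := by
  classical
  obtain ⟨s, hs⟩ : ∃ s, C.head? = some s := by
    cases C with
    | nil => simp at hne
    | cons s _ => exact ⟨s, rfl⟩
  obtain ⟨t, ht⟩ : ∃ t, C.getLast? = some t :=
    ⟨C.getLast hne, List.getLast?_eq_getLast_of_ne_nil hne⟩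
  obtain ⟨z, hz1, hz2⟩ := exists_letter hxy s t
  have hst : t.1 = s.1 → t.2 = s.2 := hC.2 t ht s hs
  obtain ⟨m, n, hm, hn, hmn⟩ := h (mk [z])
  obtain ⟨k, l, hk, hl, hkl⟩ : ∃ (k : ℕ) (l : ℤ), k ≠ 0 ∧ l ≠ 0 ∧
      mk [z] * mk C ^ k * (mk [z])⁻¹ = mk C ^ l := by
    rcases Int.natAbs_eq m with hm' | hm'
    · refine ⟨m.natAbs, n, by omega, hn, ?_⟩
      rw [← hmn]
      conv_rhs => rw [hm']
      rw [zpow_natCast]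
    · refine ⟨m.natAbs, -n, by omega, by omega, ?_⟩
      rw [zpow_neg, ← hmn]
      conv_rhs => rw [hm']
      rw [zpow_neg, zpow_natCast]
      group
  have hred : IsReduced ([z] ++ C ++ [(z.1, !z.2)]) := by
    refine IsReduced.append_overlap ?_ ?_ hne
    · rw [FreeGroup.IsReduced, List.isChain_append]
      refine ⟨by simp, hC.isReduced, ?_⟩
      intro a ha b hb
      simp only [List.getLast?_singleton, Option.mem_def, Option.some.injEq] at ha
      rw [Option.mem_def, hs, Option.some.injEq] at hb
      subst ha hb
      exact hz1
    · rw [FreeGroup.IsReduced, List.isChain_append]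
      refine ⟨hC.isReduced, by simp, ?_⟩
      intro a ha b hb
      simp only [List.head?_cons, Option.mem_def, Option.some.injEq] at hb
      rw [Option.mem_def, ht, Option.some.injEq] at ha
      subst ha hb
      intro h1
      by_contra h2
      apply hz2
      have : z.2 = t.2 := by
        revert h2; cases z.2 <;> cases t.2 <;> simp
      exact Prod.ext h1.symm this
  have hred' := IsReduced.append_flatten_replicate_append hC hred hk
  have hw : (mk [z] * mk C ^ k * (mk [z])⁻¹).toWord =
      [z] ++ (List.replicate k C).flatten ++ [(z.1, !z.2)] := by
    rw [pow_mk, inv_mk, mul_mk, mul_mk, toWord_mk]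
    exact hred'.reduce_eq
  rw [hkl] at hw
  rcases Int.natAbs_eq l with hl' | hl'
  · rw [hl', zpow_natCast, cyc_toWord_pow hC] at hw
    have h1 := congrArg List.head? hw
    have h2 := congrArg List.getLast? hw
    rw [List.head?_flatten_replicate (by omega), hs] at h1
    rw [List.getLast?_flatten_replicate (by omega), ht, List.getLast?_concat] at h2
    simp at h1 h2
    subst h1 h2
    simp at hst
  · rw [hl', zpow_neg, zpow_natCast, toWord_inv, cyc_toWord_pow hC] at hw
    have h1 := congrArg List.head? hw
    have h2 := congrArg List.getLast? hw
    simp only [invRev, List.head?_reverse, List.getLast?_reverse, List.getLast?_map,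
      List.head?_map] at h1 h2
    rw [List.getLast?_flatten_replicate (by omega), ht] at h1
    rw [List.head?_flatten_replicate (by omega), hs, List.getLast?_concat] at h2
    simp at h1 h2
    subst h1
    simp at h2
    grind

lemma not_commensurated {x y : α} (hxy : x ≠ y) (a : FreeGroup α) (ha : a ≠ 1)
    (h : ∀ g : FreeGroup α, ∃ m n : ℤ, m ≠ 0 ∧ n ≠ 0 ∧ g * a ^ m * g⁻¹ = a ^ n) : False := by
  classical
  obtain ⟨u, C, hC, hau⟩ : ∃ (u : FreeGroup α) (C : List (α × Bool)), IsCyclicallyReduced C ∧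
      a = u * mk C * u⁻¹ := by
    refine ⟨mk (reduceCyclically.conjugator a.toWord), reduceCyclically a.toWord,
      reduceCyclically.isCyclicallyReduced isReduced_toWord, ?_⟩
    rw [inv_mk, mul_mk, mul_mk, reduceCyclically.conj_conjugator_reduceCyclically, mk_toWord]
  subst hau
  refine not_conj_pow_cyc hxy C hC ?_ ?_
  · rintro rfl
    apply ha
    have h1 : (mk ([] : List (α × Bool))) = 1 := rfl
    rw [h1, mul_one, mul_inv_cancel]
  · intro g
    obtain ⟨m, n, hm, hn, hmn⟩ := h (u * g * u⁻¹)
    refine ⟨m, n, hm, hn, ?_⟩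
    rw [conj_zpow, conj_zpow] at hmn
    have : u * (g * mk C ^ m * g⁻¹) * u⁻¹ = u * mk C ^ n * u⁻¹ := by
      rw [← hmn]; group
    simpa using this

lemma free_and_commensurated {H : Type} [Group H] (hH : IsFreeGrp H) (a : H) (ha : a ≠ 1)
    (h : ∀ g : H, ∃ m n : ℤ, m ≠ 0 ∧ n ≠ 0 ∧ g * a ^ m * g⁻¹ = a ^ n) :
    Nonempty (H ≃* Multiplicative ℤ) := by
  obtain ⟨ι, ⟨e⟩⟩ := hH
  have hsub : Subsingleton ι := by
    by_contra hns
    rw [not_subsingleton_iff_nontrivial] at hns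
    obtain ⟨x, y, hxy⟩ := hns
    refine not_commensurated hxy (e a) (by simpa using ha) (fun g => ?_)
    obtain ⟨m, n, hm, hn, hmn⟩ := h (e.symm g)
    exact ⟨m, n, hm, hn, by simpa using congrArg e hmn⟩
  have hne : Nonempty ι := by
    by_contra hemp
    rw [not_nonempty_iff] at hemp
    exact ha (e.injective (Subsingleton.elim _ _))
  obtain ⟨i⟩ := hne
  have : Unique ι := ⟨⟨i⟩, fun _ => Subsingleton.elim _ _⟩
  exact ⟨e.trans FreeGroup.mulEquivIntOfUnique⟩

end FreeGroupCommensurator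

section FreeActions

open CategoryTheory

/-- The product of edge labels along a walk (later labels on the left). -/
def walkLabel {V K : Type} [Group K] {X : SimpleGraph V} (l : V → V → K) :
    {u v : V} → X.Walk u v → K
  | _, _, .nil => 1
  | u, _, .cons (v := w) _ p => walkLabel l p * l u w

lemma walkLabel_concat {V K : Type} [Group K] {X : SimpleGraph V} (l : V → V → K) {u v w : V}
    (p : X.Walk u v) (h : X.Adj v w) : walkLabel l (p.concat h) = l v w * walkLabel l p := by
  induction p with
  | nil => simp [SimpleGraph.Walk.concat, walkLabel]
  | cons h' p ih => rw [SimpleGraph.Walk.concat_cons, walkLabel, ih, walkLabel, mul_assoc]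

lemma exists_potential {V K : Type} [Group K] {X : SimpleGraph V} (hX : X.IsTree) (l : V → V → K)
    (hl : ∀ u v, X.Adj u v → l u v * l v u = 1) :
    ∃ p : V → K, ∀ u v, X.Adj u v → p v = l u v * p u := by
  classical
  obtain ⟨o⟩ := hX.connected.nonempty
  have hpath : ∀ v, ∃ w : X.Walk o v, w.IsPath := fun v => by
    obtain ⟨w⟩ := hX.connected.preconnected o v
    exact ⟨w.bypass, w.bypass_isPath⟩
  choose P hP using hpath
  refine ⟨fun v => walkLabel l (P v), fun u v huv => ?_⟩
  change walkLabel l (P v) = l u v * walkLabel l (P u)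
  by_cases hu : u ∈ (P v).support
  · rw [hX.isAcyclic.path_concat (hP u) (hP v) huv hu, walkLabel_concat]
  · have hv := hX.isAcyclic.mem_support_of_ne_mem_support_of_adj_of_isPath (hP u) (hP v) huv hu
    rw [hX.isAcyclic.path_concat (hP v) (hP u) huv.symm hv, walkLabel_concat, ← mul_assoc,
      hl u v huv, one_mul]

/-- The connected groupoid with object set `Q` and vertex group `G`. -/
def ConnGpd (_G Q : Type) : Type := Q

instance connGpdGroupoid (G Q : Type) [Group G] : Groupoid.{0} (ConnGpd G Q) where
  Hom _ _ := G
  id _ := (1 : G)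
  comp f g := (show G from g) * (show G from f)
  id_comp f := mul_one (show G from f)
  comp_id f := one_mul (show G from f)
  assoc f g h := (mul_assoc (show G from h) (show G from g) (show G from f)).symm
  inv f := (show G from f)⁻¹
  inv_comp f := mul_inv_cancel (show G from f)
  comp_inv f := inv_mul_cancel (show G from f)

lemma connGpd_connected (G Q : Type) [Group G] [Nonempty Q] : IsConnected (ConnGpd G Q) := by
  have : Nonempty (ConnGpd G Q) := ‹Nonempty Q›
  exact zigzag_isConnected fun x y =>
    Relation.ReflTransGen.single (Or.inl ⟨(1 : G)⟩)

variable {G V : Type} [Group G]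

/-- A free action without inversions has an invariant orientation. -/
lemma exists_orientation {X : SimpleGraph V} {ρ : G →* Equiv.Perm V} (hX : IsGTree X ρ) :
    ∃ pos : V → V → Prop, (∀ u v, pos u v → X.Adj u v) ∧
      (∀ u v, X.Adj u v → pos u v ∨ pos v u) ∧ (∀ u v, pos u v → ¬ pos v u) ∧
      (∀ g u v, pos u v → pos (ρ g u) (ρ g v)) := by
  classical
  let s : Setoid (V × V) :=
    { r := fun x y => ∃ g, ρ g x.1 = y.1 ∧ ρ g x.2 = y.2
      iseqv := ⟨fun x => ⟨1, by simp, by simp⟩,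
        fun {x y} ⟨g, h1, h2⟩ => ⟨g⁻¹, by rw [← h1]; simp, by rw [← h2]; simp⟩,
        fun {x y z} ⟨g, h1, h2⟩ ⟨k, h3, h4⟩ => ⟨k * g, by simp [h1, h3], by simp [h2, h4]⟩⟩ }
  obtain ⟨lin⟩ : Nonempty (LinearOrder (Quotient s)) := ⟨linearOrderOfSTO WellOrderingRel⟩
  have hinv : ∀ g u v, (Quotient.mk s (ρ g u, ρ g v)) = Quotient.mk s (u, v) := by
    intro g u v
    exact Quotient.sound ⟨g⁻¹, by simp, by simp⟩
  refine ⟨fun u v => X.Adj u v ∧ Quotient.mk s (u, v) < Quotient.mk s (v, u), ?_, ?_, ?_, ?_⟩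
  · exact fun u v h => h.1
  · intro u v h
    rcases lt_trichotomy (Quotient.mk s (u, v)) (Quotient.mk s (v, u)) with h1 | h1 | h1
    · exact Or.inl ⟨h, h1⟩
    · obtain ⟨g, h2, h3⟩ := Quotient.exact h1
      exact absurd ⟨h2, h3⟩ (hX.2.2 g u v h)
    · exact Or.inr ⟨h.symm, h1⟩
  · exact fun u v h h' => lt_asymm h.2 h'.2
  · intro g u v h
    refine ⟨hX.2.1 g u v h.1, ?_⟩
    rw [hinv, hinv]
    exact h.2

/-- A free action gives equivariant coordinates. -/
lemma exists_coords (ρ : G →* Equiv.Perm V) (hfree : ∀ g v, ρ g v = v → g = 1) :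
    ∃ (Q : Type) (r : Q → V) (q : V → Q) (h : V → G), (∀ v, ρ (h v) (r (q v)) = v) ∧
      (∀ g a, q (ρ g (r a)) = a) ∧ (∀ g a, h (ρ g (r a)) = g) := by
  classical
  let s : Setoid V :=
    { r := fun x y => ∃ g, ρ g x = y
      iseqv := ⟨fun x => ⟨1, by simp⟩,
        fun {x y} ⟨g, h1⟩ => ⟨g⁻¹, by rw [← h1]; simp⟩,
        fun {x y z} ⟨g, h1⟩ ⟨k, h3⟩ => ⟨k * g, by simp [h1, h3]⟩⟩ }
  have hex : ∀ v : V, ∃ g, ρ g (Quotient.mk s v).out = v := fun v =>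
    Quotient.exact (Quotient.out_eq (Quotient.mk s v))
  choose h hh using hex
  have hq : ∀ g (a : Quotient s), Quotient.mk s (ρ g a.out) = a := by
    intro g a
    conv_rhs => rw [← Quotient.out_eq a]
    exact Quotient.sound ⟨g⁻¹, by simp⟩
  refine ⟨Quotient s, Quotient.out, Quotient.mk s, h, hh, hq, fun g a => ?_⟩
  have h1 := hh (ρ g a.out)
  rw [hq] at h1
  have h2 : ρ (g⁻¹ * h (ρ g a.out)) a.out = a.out := by simp [h1]
  have h3 := hfree _ _ h2
  exact (inv_mul_eq_one.1 h3).symm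

theorem free_of_free_action {X : SimpleGraph V} {ρ : G →* Equiv.Perm V} (hX : IsGTree X ρ)
    (hfree : ∀ g v, ρ g v = v → g = 1) : IsFreeGrp G := by
  classical
  obtain ⟨pos, hadj, htot, hasymm, hposinv⟩ := exists_orientation hX
  obtain ⟨Q, r, q, h, hcoord, hq, hh⟩ := exists_coords ρ hfree
  have hmul : ∀ g k v, ρ g (ρ k v) = ρ (g * k) v := fun g k v => by simp
  have hq' : ∀ g v, q (ρ g v) = q v := by
    intro g v
    conv_lhs => rw [← hcoord v, hmul, hq]
  have hh' : ∀ g v, h (ρ g v) = g * h v := by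
    intro g v
    conv_lhs => rw [← hcoord v, hmul, hh]
  have hqr : ∀ a, q (r a) = a := fun a => by simpa using hq 1 a
  have hhr : ∀ a, h (r a) = 1 := fun a => by simpa using hh 1 a
  have hne : Nonempty Q := by
    obtain ⟨v⟩ := hX.1.connected.nonempty
    exact ⟨q v⟩
  have := connGpd_connected G Q
  let : IsFreeGroupoid (ConnGpd G Q) :=
    { quiverGenerators := ⟨fun (a b : Q) => {m : G // pos (ρ m (r a)) (r b)}⟩
      of := fun {a b} m => m.1
      unique_lift := by
        intro K _ f
        let fl : Q → Q → G → K := fun a b m =>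
          if hp : pos (ρ m (r a)) (r b) then @f a b ⟨m, hp⟩ else 1
        let l : V → V → K := fun v w =>
          if pos v w then fl (q v) (q w) ((h w)⁻¹ * h v)
          else if pos w v then (fl (q w) (q v) ((h v)⁻¹ * h w))⁻¹ else 1
        have hl : ∀ u v, X.Adj u v → l u v * l v u = 1 := by
          intro u v huv
          rcases htot u v huv with h1 | h1
          · have h2 := hasymm _ _ h1
            simp [l, h1, h2]
          · have h2 := hasymm _ _ h1
            simp [l, h1, h2]
        obtain ⟨p, hp⟩ := exists_potential hX.1 l hl
        have hpi : ∀ g u v, pos (ρ g u) (ρ g v) ↔ pos u v := by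
          intro g u v
          refine ⟨fun h1 => ?_, hposinv g u v⟩
          simpa using hposinv g⁻¹ _ _ h1
        have hlinv : ∀ g u v, l (ρ g u) (ρ g v) = l u v := by
          intro g u v
          simp only [l, hpi, hq', hh', mul_inv_rev, mul_assoc, inv_mul_cancel_left]
        have hpinv : ∀ g u v, p (ρ g v) * (p (ρ g u))⁻¹ = p v * (p u)⁻¹ := by
          intro g u v
          obtain ⟨w⟩ := hX.1.connected.preconnected u v
          induction w with
          | nil => simp
          | @cons u w v huw _ ih =>
            have h1 := hp _ _ huw
            have h2 := hp _ _ (hX.2.1 g _ _ huw)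
            rw [hlinv] at h2
            have e1 : (p (ρ g u))⁻¹ = (p (ρ g w))⁻¹ * l u w := by rw [h2]; group
            have e2 : (p u)⁻¹ = (p w)⁻¹ * l u w := by rw [h1]; group
            rw [e1, e2, ← mul_assoc, ih, mul_assoc]
        let F : ConnGpd G Q ⥤ SingleObj K :=
          { obj := fun _ => ()
            map := fun {a b} m => (p (r b) * (p (ρ (show G from m) (r a)))⁻¹ : K)
            map_id := by
              intro a
              change p (r a) * (p (ρ (1 : G) (r a)))⁻¹ = (1 : K)
              simp
            map_comp := by
              intro a b c m n
              change p (r c) * (p (ρ ((show G from n) * (show G from m)) (r a)))⁻¹ =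
                (p (r c) * (p (ρ (show G from n) (r b)))⁻¹) *
                (p (r b) * (p (ρ (show G from m) (r a)))⁻¹)
              rw [← hpinv n (ρ (show G from m) (r a)) (r b), hmul]
              group }
        have hF : ∀ (a b : Q) (m : G) (hm : pos (ρ m (r a)) (r b)),
            p (r b) * (p (ρ m (r a)))⁻¹ = @f a b ⟨m, hm⟩ := by
          intro a b m hm
          rw [hp _ _ (hadj _ _ hm), mul_inv_cancel_right]
          have h1 : l (ρ m (r a)) (r b) = fl a b m := by
            simp only [l, if_pos hm, hq, hqr, hh, hhr, inv_one, one_mul]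
          rw [h1]
          exact dif_pos hm
        refine ⟨F, fun a b m => hF a b m.1 m.2, ?_⟩
        intro E hE
        have hEgen : ∀ (a b : ConnGpd G Q) (m : G), pos (ρ m (r a)) (r b) →
            (E.map (X := a) (Y := b) m : K) = (F.map (X := a) (Y := b) m : K) := by
          intro a b m hm
          exact (hE a b ⟨m, hm⟩).trans (hF a b m hm).symm
        have hmapinv : ∀ (E : ConnGpd G Q ⥤ SingleObj K) (a b : ConnGpd G Q) (m : G),
            (E.map (X := b) (Y := a) m⁻¹ : K) = (E.map (X := a) (Y := b) m : K)⁻¹ := by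
          intro E a b m
          have h1 := E.map_comp (X := a) (Y := b) (Z := a) m m⁻¹
          have h2 : E.map (X := a) (Y := a) (1 : G) = (1 : K) := E.map_id a
          have h3 : (E.map (X := a) (Y := a) (m⁻¹ * m : G) : K) =
            (E.map (X := b) (Y := a) m⁻¹ : K) * (E.map (X := a) (Y := b) m : K) := h1
          rw [inv_mul_cancel] at h3
          exact eq_inv_of_mul_eq_one_left (h3.symm.trans h2)
        have hedge : ∀ u v : V, X.Adj u v → ∀ (a b : ConnGpd G Q) (g k : G),
            u = ρ g (r a) → v = ρ k (r b) →
            (E.map (X := a) (Y := b) (k⁻¹ * g : G) : K) =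
              (F.map (X := a) (Y := b) (k⁻¹ * g : G) : K) := by
          intro u v huv a b g k hu hv
          rcases htot u v huv with h1 | h1
          · apply hEgen
            rw [← hpi k, hmul, mul_inv_cancel_left, ← hu, ← hv]
            exact h1
          · have h2 : (E.map (X := b) (Y := a) (g⁻¹ * k : G) : K) =
              (F.map (X := b) (Y := a) (g⁻¹ * k : G) : K) := by
              apply hEgen
              rw [← hpi g, hmul, mul_inv_cancel_left, ← hu, ← hv]
              exact h1
            have h3 : (k⁻¹ * g : G) = (g⁻¹ * k)⁻¹ := by group
            rw [h3, hmapinv, hmapinv, h2]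
        have hwalk : ∀ (u v : V), X.Walk u v → ∀ (a b : ConnGpd G Q) (g k : G),
            u = ρ g (r a) → v = ρ k (r b) →
            (E.map (X := a) (Y := b) (k⁻¹ * g : G) : K) =
              (F.map (X := a) (Y := b) (k⁻¹ * g : G) : K) := by
          intro u v w
          induction w with
          | @nil u =>
            intro a b g k hu hv
            have hab : a = b := by
              exact (hq g a).symm.trans ((congrArg q (hu.symm.trans hv)).trans (hq k b))
            have hgk : g = k := by
              exact (hh g a).symm.trans ((congrArg h (hu.symm.trans hv)).trans (hh k b))
            subst hab hgk
            rw [inv_mul_cancel]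
            exact (E.map_id a).trans (F.map_id a).symm
          | @cons u w v huw _ ih =>
            intro a b g k hu hv
            have hw := (hcoord w).symm
            have h1 := hedge u w huw a (q w) g (h w) hu hw
            have h2 := ih (q w) b (h w) k hw hv
            have hcomp : ∀ E : ConnGpd G Q ⥤ SingleObj K,
                (E.map (X := a) (Y := b) (k⁻¹ * h w * ((h w)⁻¹ * g) : G) : K) =
                (E.map (X := (q w : Q)) (Y := b) (k⁻¹ * h w : G) : K) *
                (E.map (X := a) (Y := (q w : Q)) ((h w)⁻¹ * g : G) : K) := fun E =>
              E.map_comp (X := a) (Y := (q w : Q)) (Z := b) ((h w)⁻¹ * g : G) (k⁻¹ * h w : G)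
            have h3 : (k⁻¹ * g : G) = k⁻¹ * h w * ((h w)⁻¹ * g) := by group
            rw [h3, hcomp E, hcomp F, h1, h2]
        apply CategoryTheory.Functor.hext
        · intro _; rfl
        · intro a b m
          apply heq_of_eq
          obtain ⟨w⟩ := hX.1.connected.preconnected (ρ (show G from m) (r a)) (r b)
          have := hwalk _ _ w a b m 1 rfl (by simp)
          rw [inv_one, one_mul] at this
          exact this }
  obtain ⟨a⟩ := hne
  have hfr : IsFreeGroup (End (show ConnGpd G Q from a)) := inferInstance
  let e : End (show ConnGpd G Q from a) ≃* G :=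
    { toFun := fun x => x
      invFun := fun x => x
      left_inv := fun _ => rfl
      right_inv := fun _ => rfl
      map_mul' := fun _ _ => rfl }
  have : IsFreeGroup G := IsFreeGroup.ofMulEquiv e
  exact ⟨IsFreeGroup.Generators G, ⟨(IsFreeGroup.toFreeGroup G)⟩⟩

end FreeActions

/-- Every subgroup of the group of a generalized
Baumslag–Solitar tree is either a generalized Baumslag–Solitar group or a free
group, and the only group which is both is `ℤ`. -/
theorem gbs_subgroup_dichotomy {G V : Type} [Group G]
    (X : SimpleGraph V) (ρ : G →* Equiv.Perm V) (hX : IsGBSTree X ρ) :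
    (∀ H : Subgroup G, IsGBSGroup H ∨ IsFreeGrp H) ∧
    (∀ H : Subgroup G, IsGBSGroup H → IsFreeGrp H →
      Nonempty (H ≃* Multiplicative ℤ)) := by
  constructor
  · intro H
    by_cases hex : ∃ a ∈ H, ∃ v : V, ρ a v = v ∧ a ≠ 1
    · obtain ⟨a, haH, v, hv, h1⟩ := hex
      exact Or.inl ⟨V, X, ρ.comp H.subtype, hX.subgroup H haH v hv h1⟩
    · right
      refine free_of_free_action (X := X) (ρ := ρ.comp H.subtype)
        ⟨hX.1.1, fun g => hX.1.2.1 g, fun g => hX.1.2.2 g⟩ ?_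
      intro g v hgv
      by_contra h1
      exact hex ⟨g.1, g.2, v, hgv, fun h => h1 (Subtype.ext h)⟩
  · rintro H ⟨W, Y, σ, hY⟩ hfree
    obtain ⟨a, ha, h⟩ := hY.exists_commensurated
    exact free_and_commensurated hfree a ha h
end
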